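/- arXiv:1908.08237 — 10 statements merged into one kernel-verified Lean document; each statement's English description precedes it below -/
import Mathlib

section
/- For every integer n ≥ 10, ot(n, K_{1,3} ∪ K_2) = n; that is, every 2-edge-colouring of K_n with min{|R|,|B|} ≥ n+1 contains, for each pair r,b ≥ 0 with r+b = 4, an (r,b)-coloured copy of K_{1,3} ∪ K_2, and there is a 2-edge-colouring of K_n with min{|R|,|B|} = n admitting no (4,0)-coloured copy of K_{1,3} ∪ K_2. -/
/-- The set of red edges of a 2-edge-colouring of `K_n`
    (`true` = red, `false` = blue). -/
def redEdges (n : ℕ) (c : Sym2 (Fin n) → Bool) : Finset (Sym2 (Fin n)) :=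
  (⊤ : SimpleGraph (Fin n)).edgeFinset.filter (fun e => c e = true)

/-- The set of blue edges of a 2-edge-colouring of `K_n`. -/
def blueEdges (n : ℕ) (c : Sym2 (Fin n) → Bool) : Finset (Sym2 (Fin n)) :=
  (⊤ : SimpleGraph (Fin n)).edgeFinset.filter (fun e => c e = false)

/-- An `(r,b)`-coloured copy of `K_{1,3} ∪ K_2` in a 2-edge-coloured `K_n`:
six distinct vertices `v, a₁, a₂, a₃, x, y` forming the star with centre `v`
and leaves `a₁, a₂, a₃` together with the independent edge `xy`, such that
exactly `r` of the four edges are red and exactly `b` are blue. -/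
def K13K2Copy (n : ℕ) (c : Sym2 (Fin n) → Bool) (r b : ℕ) : Prop :=
  ∃ v a₁ a₂ a₃ x y : Fin n, ([v, a₁, a₂, a₃, x, y] : List (Fin n)).Nodup ∧
    ((if c s(v, a₁) = true then 1 else 0) + (if c s(v, a₂) = true then 1 else 0) +
      (if c s(v, a₃) = true then 1 else 0) + (if c s(x, y) = true then 1 else 0) = r) ∧
    ((if c s(v, a₁) = false then 1 else 0) + (if c s(v, a₂) = false then 1 else 0) +
      (if c s(v, a₃) = false then 1 else 0) + (if c s(x, y) = false then 1 else 0) = b)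

/-- Six distinct vertices forming a star with one edge in `A` and two edges in `B`, together with
an independent edge in `H`. -/
def StarEdge {V : Type*} (A B H : SimpleGraph V) : Prop :=
  ∃ v a₁ a₂ a₃ x y : V, ([v, a₁, a₂, a₃, x, y] : List V).Nodup ∧
    A.Adj v a₁ ∧ B.Adj v a₂ ∧ B.Adj v a₃ ∧ H.Adj x y

section StarEdge

open Finset

variable {V : Type*} (G : SimpleGraph V)

theorem exists_adj_and_compl_adj {G : SimpleGraph V} {a b p q : V}
    (hab : G.Adj a b) (hpq : Gᶜ.Adj p q) : ∃ v u w, G.Adj v u ∧ Gᶜ.Adj v w := by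
  by_cases hap : a = p
  · exact ⟨a, b, q, hab, hap ▸ hpq⟩
  by_cases h : G.Adj a p
  · exact ⟨p, a, q, h.symm, hpq⟩
  · exact ⟨a, b, p, hab, by simp [hap, h]⟩

variable [Fintype V] [DecidableRel G.Adj]

theorem exists_adj_notMem_of_card_lt {S : Finset (Sym2 V)} (h : #S < #G.edgeFinset) :
    ∃ x y, G.Adj x y ∧ s(x, y) ∉ S := by
  obtain ⟨e, he, heS⟩ := exists_mem_notMem_of_card_lt_card h
  induction e with
  | h x y => exact ⟨x, y, by simpa using he, heS⟩

theorem two_mul_card_edgeFinset_le {d : ℕ} (h : ∀ v, G.degree v ≤ d) :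
    2 * #G.edgeFinset ≤ Fintype.card V * d := by
  rw [← G.sum_degrees_eq_twice_card_edges]
  simpa using sum_le_card_nsmul univ (fun v => G.degree v) d (fun v _ => h v)

theorem exists_max_degree_three_le (h : Fintype.card V < #G.edgeFinset) :
    ∃ v, 3 ≤ G.degree v ∧ ∀ w, G.degree w ≤ G.degree v := by
  obtain ⟨x, _, -, -⟩ := exists_adj_notMem_of_card_lt G (S := ∅) (by rw [card_empty]; omega)
  obtain ⟨v, -, hv⟩ := exists_max_image univ (fun v => G.degree v) ⟨x, mem_univ x⟩
  refine ⟨v, ?_, fun w => hv w (mem_univ w)⟩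
  by_contra! hlt
  have := two_mul_card_edgeFinset_le G (d := 2) fun w =>
    (hv w (mem_univ w)).trans (Nat.le_of_lt_succ hlt)
  omega

variable [DecidableEq V]

theorem exists_adj_ne_ne (h : Fintype.card V ≤ #G.edgeFinset) (v : V) :
    ∃ x y, G.Adj x y ∧ x ≠ v ∧ y ≠ v := by
  have hlt : #(G.incidenceFinset v) < #G.edgeFinset := by
    rw [G.card_incidenceFinset_eq_degree]
    exact (G.degree_lt_card_verts v).trans_le h
  obtain ⟨x, y, hxy, hS⟩ := exists_adj_notMem_of_card_lt G hlt
  refine ⟨x, y, hxy, ?_, ?_⟩ <;> rintro rfl <;> simp [SimpleGraph.incidenceSet, hxy] at hS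

variable {G}

theorem starEdge_of_three_le_card {H : SimpleGraph V} {v x y : V}
    (h : 3 ≤ #(G.neighborFinset v \ {x, y})) (hxy : H.Adj x y) (hx : x ≠ v) (hy : y ≠ v) :
    StarEdge G G H := by
  obtain ⟨a, ha, b, hb, c, hc, hab, hac, hbc⟩ := two_lt_card.mp h
  simp only [mem_sdiff, SimpleGraph.mem_neighborFinset, mem_insert, mem_singleton,
    not_or] at ha hb hc
  have := ha.1.ne
  have := hb.1.ne
  have := hc.1.ne
  have := hxy.ne
  refine ⟨v, a, b, c, x, y, ?_, ha.1, hb.1, hc.1, hxy⟩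
  simp only [List.nodup_cons, List.mem_cons, List.not_mem_nil, List.nodup_nil]
  grind

theorem starEdge_of_five_le_degree {H : SimpleGraph V} {v x y : V}
    (h : 5 ≤ G.degree v) (hxy : H.Adj x y) (hx : x ≠ v) (hy : y ≠ v) :
    StarEdge G G H := by
  refine starEdge_of_three_le_card ?_ hxy hx hy
  have := le_card_sdiff {x, y} (G.neighborFinset v)
  have := card_le_two (a := x) (b := y)
  rw [G.card_neighborFinset_eq_degree] at *
  omega

theorem starEdge_self (hV : 10 ≤ Fintype.card V) (h : Fintype.card V < #G.edgeFinset) :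
    StarEdge G G G := by
  obtain ⟨v, hv, hmax⟩ := exists_max_degree_three_le G h
  rcases Nat.lt_or_ge 4 (G.degree v) with h5 | h4
  · obtain ⟨x, y, hxy, hx, hy⟩ := exists_adj_ne_ne G h.le v
    exact starEdge_of_five_le_degree h5 hxy hx hy
  obtain h4 | h3 : G.degree v = 4 ∨ G.degree v = 3 := by omega
  · have hS : #(insert v (G.neighborFinset v)) = 5 := by
      rw [card_insert_of_notMem (by simp), G.card_neighborFinset_eq_degree, h4]
    obtain ⟨x, y, hxy, hN⟩ := exists_adj_notMem_of_card_lt G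
      (S := (insert v (G.neighborFinset v)).offDiag.image (Function.uncurry Sym2.mk)) (by
        rw [Sym2.card_image_offDiag, hS]
        simp [Nat.choose]
        omega)
    have hout : x ∉ insert v (G.neighborFinset v) ∨ y ∉ insert v (G.neighborFinset v) := by
      by_contra! hin
      exact hN (mem_image.mpr ⟨(x, y), mem_offDiag.mpr ⟨hin.1, hin.2, hxy.ne⟩, rfl⟩)
    wlog hy : y ∉ insert v (G.neighborFinset v) generalizing x y
    · exact this y x hxy.symm (by rwa [Sym2.eq_swap]) hout.symm (hout.resolve_right hy)
    simp only [mem_insert, SimpleGraph.mem_neighborFinset, not_or] at hy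
    refine starEdge_of_three_le_card (v := v) ?_ hxy (by rintro rfl; exact hy.2 hxy) hy.1
    have hsub : (G.neighborFinset v).erase x ⊆ G.neighborFinset v \ {x, y} := by
      intro w
      simp only [mem_erase, mem_sdiff, SimpleGraph.mem_neighborFinset, mem_insert, mem_singleton]
      rintro ⟨hwx, hw⟩
      refine ⟨hw, ?_⟩
      rintro (rfl | rfl)
      exacts [hwx rfl, hy.2 hw]
    have := card_le_card hsub
    have := pred_card_le_card_erase (s := G.neighborFinset v) (a := x)
    rw [G.card_neighborFinset_eq_degree] at this
    omega
  · obtain ⟨x, y, hxy, hN⟩ := exists_adj_notMem_of_card_lt G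
      (S := (G.neighborFinset v).biUnion fun u => G.incidenceFinset u) (by
        have := card_biUnion_le_card_mul (G.neighborFinset v) (fun u => G.incidenceFinset u) 3
          fun u _ => by rw [G.card_incidenceFinset_eq_degree, ← h3]; exact hmax u
        rw [G.card_neighborFinset_eq_degree] at this
        omega)
    have hx : ¬ G.Adj v x := fun hvx =>
      hN (mem_biUnion.mpr ⟨x, by simpa using hvx, by simp [SimpleGraph.incidenceSet, hxy]⟩)
    have hy : ¬ G.Adj v y := fun hvy =>
      hN (mem_biUnion.mpr ⟨y, by simpa using hvy, by simp [SimpleGraph.incidenceSet, hxy]⟩)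
    refine starEdge_of_three_le_card (v := v) ?_ hxy
      (by rintro rfl; exact hy hxy) (by rintro rfl; exact hx hxy.symm)
    rw [sdiff_eq_self_of_disjoint, G.card_neighborFinset_eq_degree, h3]
    simp [hx, hy]

theorem starEdge_compl (hV : 10 ≤ Fintype.card V) (h : Fintype.card V < #G.edgeFinset)
    (h' : Fintype.card V < #Gᶜ.edgeFinset) : StarEdge G G Gᶜ := by
  obtain ⟨v, hv, hmax⟩ := exists_max_degree_three_le G h
  rcases Nat.lt_or_ge 4 (G.degree v) with h5 | h4
  · obtain ⟨x, y, hxy, hx, hy⟩ := exists_adj_ne_ne Gᶜ h'.le v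
    exact starEdge_of_five_le_degree h5 hxy hx hy
  rw [← G.card_neighborFinset_eq_degree] at hv
  obtain ⟨T, hT, hT3⟩ := exists_subset_card_eq hv
  have hW := card_compl (insert v T)
  have := card_insert_le v T
  obtain ⟨w, hw⟩ : (insert v T)ᶜ.Nonempty := card_pos.mp (by omega)
  obtain ⟨y, hy, hyN⟩ : ∃ y ∈ (insert v T)ᶜ.erase w, y ∉ G.neighborFinset w := by
    refine exists_mem_notMem_of_card_lt_card ?_
    rw [card_erase_of_mem hw, G.card_neighborFinset_eq_degree]
    have := hmax w
    omega
  simp only [mem_erase, mem_compl, mem_insert, not_or, SimpleGraph.mem_neighborFinset]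
    at hw hy hyN
  refine starEdge_of_three_le_card (v := v) (x := w) (y := y) ?_
    (by simpa [hyN] using hy.1.symm) hw.1 hy.2.1
  rw [← hT3]
  refine card_le_card (subset_sdiff.mpr ⟨hT, ?_⟩)
  simp [hw.2, hy.2.2]

theorem starEdge_compl_of_five_le_degree (h : Fintype.card V < #G.edgeFinset) {v u : V}
    (hvu : G.Adj v u) (hd : 5 ≤ Gᶜ.degree v) : StarEdge G Gᶜ G := by
  obtain ⟨x, y, a, hxy, hx, hy, hva, hax, hay⟩ :
      ∃ x y a, G.Adj x y ∧ x ≠ v ∧ y ≠ v ∧ G.Adj v a ∧ a ≠ x ∧ a ≠ y := by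
    rcases Nat.lt_or_ge 2 (G.degree v) with h3 | h2
    · obtain ⟨x, y, hxy, hx, hy⟩ := exists_adj_ne_ne G h.le v
      obtain ⟨a, ha, hna⟩ := exists_mem_notMem_of_card_lt_card
        (s := {x, y}) (t := G.neighborFinset v)
        (by rw [G.card_neighborFinset_eq_degree]; exact card_le_two.trans_lt h3)
      simp only [mem_insert, mem_singleton, not_or, SimpleGraph.mem_neighborFinset] at ha hna
      exact ⟨x, y, a, hxy, hx, hy, ha, hna⟩
    · obtain ⟨x, y, hxy, hN⟩ := exists_adj_notMem_of_card_lt G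
        (S := (G.incidenceFinset v).erase s(v, u) ∪ G.incidenceFinset u) (by
          have := card_union_le ((G.incidenceFinset v).erase s(v, u)) (G.incidenceFinset u)
          rw [card_erase_of_mem (by simp [SimpleGraph.incidenceSet, hvu]),
            G.card_incidenceFinset_eq_degree, G.card_incidenceFinset_eq_degree] at this
          have := G.degree_lt_card_verts u
          omega)
      simp only [mem_union, mem_erase, SimpleGraph.mem_incidenceFinset,
        SimpleGraph.incidenceSet, Set.mem_ofPred_eq, SimpleGraph.mem_edgeSet, hxy, true_and,
        Sym2.mem_iff, not_or] at hN
      refine ⟨x, y, u, hxy, ?_, ?_, hvu, hN.2.1, hN.2.2⟩ <;> grind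
  obtain ⟨b, hb, c, hc, hbc⟩ := one_lt_card.mp (show 1 < #(Gᶜ.neighborFinset v \ {x, y}) by
    have := le_card_sdiff {x, y} (Gᶜ.neighborFinset v)
    have := card_le_two (a := x) (b := y)
    rw [Gᶜ.card_neighborFinset_eq_degree] at *
    omega)
  simp only [mem_sdiff, SimpleGraph.mem_neighborFinset, mem_insert, mem_singleton,
    not_or] at hb hc
  refine ⟨v, a, b, c, x, y, ?_, hva, hb.1, hc.1, hxy⟩
  have := hva.ne
  have := hxy.ne
  simp only [SimpleGraph.compl_adj] at hb hc
  simp only [List.nodup_cons, List.mem_cons, List.not_mem_nil, List.nodup_nil]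
  grind

theorem starEdge_mixed (hV : 10 ≤ Fintype.card V) (h : Fintype.card V < #G.edgeFinset)
    (h' : Fintype.card V < #Gᶜ.edgeFinset) : StarEdge G Gᶜ G ∨ StarEdge Gᶜ G Gᶜ := by
  obtain ⟨a, b, hab, -⟩ := exists_adj_notMem_of_card_lt G (S := ∅) (by rw [card_empty]; omega)
  obtain ⟨p, q, hpq, -⟩ := exists_adj_notMem_of_card_lt Gᶜ (S := ∅) (by rw [card_empty]; omega)
  obtain ⟨v, u, w, hu, hw⟩ := exists_adj_and_compl_adj hab hpq
  have hdeg := G.degree_compl v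
  rcases Nat.lt_or_ge 4 (Gᶜ.degree v) with h5 | h4
  · exact .inl (starEdge_compl_of_five_le_degree h hu h5)
  · right
    have hcc : Gᶜᶜ.degree v = G.degree v := by simp [← SimpleGraph.card_neighborSet_eq_degree]
    have := starEdge_compl_of_five_le_degree (G := Gᶜ) h' (v := v) (u := w) hw (by omega)
    rwa [compl_compl] at this

end StarEdge

/-- The graph of red edges of a colouring. -/
def redGraph (n : ℕ) (c : Sym2 (Fin n) → Bool) : SimpleGraph (Fin n) :=
  SimpleGraph.fromEdgeSet {e | c e = true}

theorem redGraph_adj {n : ℕ} {c : Sym2 (Fin n) → Bool} {x y : Fin n} :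
    (redGraph n c).Adj x y ↔ c s(x, y) = true ∧ x ≠ y := by
  simp [redGraph]

theorem redGraph_compl_adj {n : ℕ} {c : Sym2 (Fin n) → Bool} {x y : Fin n} :
    (redGraph n c)ᶜ.Adj x y ↔ c s(x, y) = false ∧ x ≠ y := by
  rw [SimpleGraph.compl_adj, redGraph_adj]
  grind

instance (n : ℕ) (c : Sym2 (Fin n) → Bool) : DecidableRel (redGraph n c).Adj :=
  fun _ _ => decidable_of_iff _ redGraph_adj.symm

theorem edgeFinset_redGraph (n : ℕ) (c : Sym2 (Fin n) → Bool) :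
    (redGraph n c).edgeFinset = redEdges n c := by
  ext e
  induction e with
  | h x y => simp [redEdges, redGraph_adj, and_comm]

theorem edgeFinset_redGraph_compl (n : ℕ) (c : Sym2 (Fin n) → Bool) :
    (redGraph n c)ᶜ.edgeFinset = blueEdges n c := by
  ext e
  induction e with
  | h x y =>
    rw [SimpleGraph.mem_edgeFinset, SimpleGraph.mem_edgeSet, redGraph_compl_adj]
    simp [blueEdges, and_comm]

theorem K13K2Copy_of_lt_card {n : ℕ} (hn : 10 ≤ n) {c : Sym2 (Fin n) → Bool}
    (hR : n < (redEdges n c).card) (hB : n < (blueEdges n c).card) {r b : ℕ} (hrb : r + b = 4) :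
    K13K2Copy n c r b := by
  rw [← edgeFinset_redGraph] at hR
  rw [← edgeFinset_redGraph_compl] at hB
  have hV : 10 ≤ Fintype.card (Fin n) := by simpa using hn
  replace hR : Fintype.card (Fin n) < (redGraph n c).edgeFinset.card := by simpa using hR
  replace hB : Fintype.card (Fin n) < (redGraph n c)ᶜ.edgeFinset.card := by
    rwa [Fintype.card_fin]
  have hR' : Fintype.card (Fin n) < (redGraph n c)ᶜᶜ.edgeFinset.card := by
    convert hR using 2
    ext e
    simp only [SimpleGraph.mem_edgeFinset, compl_compl]
  obtain ⟨rfl, rfl⟩ | ⟨rfl, rfl⟩ | ⟨rfl, rfl⟩ | ⟨rfl, rfl⟩ | ⟨rfl, rfl⟩ :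
      r = 4 ∧ b = 0 ∨ r = 3 ∧ b = 1 ∨ r = 2 ∧ b = 2 ∨ r = 1 ∧ b = 3 ∨ r = 0 ∧ b = 4 := by
    omega
  · obtain ⟨v, a₁, a₂, a₃, x, y, hnd, h₁, h₂, h₃, hxy⟩ := starEdge_self hV hR
    rw [redGraph_adj] at h₁ h₂ h₃ hxy
    exact ⟨v, a₁, a₂, a₃, x, y, hnd, by simp [h₁, h₂, h₃, hxy]⟩
  · obtain ⟨v, a₁, a₂, a₃, x, y, hnd, h₁, h₂, h₃, hxy⟩ := starEdge_compl hV hR hB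
    rw [redGraph_adj] at h₁ h₂ h₃
    rw [redGraph_compl_adj] at hxy
    exact ⟨v, a₁, a₂, a₃, x, y, hnd, by simp [h₁, h₂, h₃, hxy]⟩
  · obtain ⟨v, a₁, a₂, a₃, x, y, hnd, h₁, h₂, h₃, hxy⟩ |
      ⟨v, a₁, a₂, a₃, x, y, hnd, h₁, h₂, h₃, hxy⟩ := starEdge_mixed hV hR hB
    · rw [redGraph_adj] at h₁ hxy
      rw [redGraph_compl_adj] at h₂ h₃
      exact ⟨v, a₁, a₂, a₃, x, y, hnd, by simp [h₁, h₂, h₃, hxy]⟩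
    · rw [redGraph_compl_adj] at h₁ hxy
      rw [redGraph_adj] at h₂ h₃
      exact ⟨v, a₁, a₂, a₃, x, y, hnd, by simp [h₁, h₂, h₃, hxy]⟩
  · obtain ⟨v, a₁, a₂, a₃, x, y, hnd, h₁, h₂, h₃, hxy⟩ := starEdge_compl hV hB hR'
    rw [redGraph_compl_adj] at h₁ h₂ h₃
    rw [compl_compl, redGraph_adj] at hxy
    exact ⟨v, a₁, a₂, a₃, x, y, hnd, by simp [h₁, h₂, h₃, hxy]⟩
  · obtain ⟨v, a₁, a₂, a₃, x, y, hnd, h₁, h₂, h₃, hxy⟩ := starEdge_self hV hB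
    rw [redGraph_compl_adj] at h₁ h₂ h₃ hxy
    exact ⟨v, a₁, a₂, a₃, x, y, hnd, by simp [h₁, h₂, h₃, hxy]⟩

theorem card_redEdges_add_card_blueEdges (n : ℕ) (c : Sym2 (Fin n) → Bool) :
    (redEdges n c).card + (blueEdges n c).card = n.choose 2 := by
  have := Finset.card_filter_add_card_filter_not (s := (⊤ : SimpleGraph (Fin n)).edgeFinset)
    (fun e => c e = true)
  rw [SimpleGraph.card_edgeFinset_top_eq_card_choose_two, Fintype.card_fin] at this
  simpa [redEdges, blueEdges] using this

/-- The colouring of `K_n` whose red edges form the Hamiltonian cycle `0, 1, …, n - 1`. -/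
def cycleColouring (n : ℕ) [NeZero n] (e : Sym2 (Fin n)) : Bool :=
  decide (∃ i : Fin n, s(i, i + 1) = e)

theorem card_redEdges_cycleColouring {n : ℕ} [NeZero n] (hn : 3 ≤ n) :
    (redEdges n (cycleColouring n)).card = n := by
  have hred : redEdges n (cycleColouring n) =
      Finset.univ.image fun i : Fin n => s(i, i + 1) := by
    ext e
    simp only [redEdges, cycleColouring, Finset.mem_filter, SimpleGraph.mem_edgeFinset,
      decide_eq_true_eq, Finset.mem_image, Finset.mem_univ, true_and, and_iff_right_iff_imp]
    rintro ⟨i, rfl⟩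
    simp only [SimpleGraph.mem_edgeSet, SimpleGraph.top_adj, ne_eq]
    rw [left_eq_add, Fin.ext_iff, Fin.val_one', Fin.val_zero, Nat.mod_eq_of_lt (by omega)]
    exact one_ne_zero
  rw [hred, Finset.card_image_of_injective, Finset.card_univ, Fintype.card_fin]
  intro i j hij
  obtain ⟨h, -⟩ | ⟨h, h'⟩ := Sym2.eq_iff.mp hij
  · exact h
  · have h2 : (1 : Fin n) + 1 = 0 := by rwa [h, add_assoc, add_eq_left] at h'
    rw [Fin.ext_iff, Fin.val_add, Fin.val_one', Fin.val_zero, Nat.mod_eq_of_lt (a := 1) (by omega),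
      Nat.mod_eq_of_lt (by omega)] at h2
    omega

theorem not_K13K2Copy_cycleColouring {n : ℕ} [NeZero n] :
    ¬ K13K2Copy n (cycleColouring n) 4 0 := by
  rintro ⟨v, a, b, d, x, y, hnd, -, h⟩
  have hadj : ∀ w, cycleColouring n s(v, w) = true → w = v + 1 ∨ w = v - 1 := by
    intro w hw
    obtain ⟨i, hi⟩ := of_decide_eq_true hw
    obtain ⟨rfl, rfl⟩ | ⟨rfl, rfl⟩ := Sym2.eq_iff.mp hi
    · exact .inl rfl
    · exact .inr (add_sub_cancel_right _ _).symm
  have ha := hadj a (by grind)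
  have hb := hadj b (by grind)
  have hd := hadj d (by grind)
  simp only [List.nodup_cons, List.mem_cons, List.not_mem_nil, List.nodup_nil] at hnd
  grind

/-- For every `n ≥ 10`, `ot(n, K_{1,3} ∪ K_2) = n`: every 2-edge-colouring of `K_n` with
`min{|R|,|B|} ≥ n+1` contains an `(r,b)`-coloured copy of `K_{1,3} ∪ K_2` for every
`r, b ≥ 0` with `r + b = 4`, and there is a 2-edge-colouring of `K_n` with
`min{|R|,|B|} = n` admitting no `(4,0)`-coloured copy of `K_{1,3} ∪ K_2`. -/
theorem ot_K13_union_K2 (n : ℕ) (hn : 10 ≤ n) :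
    (∀ c : Sym2 (Fin n) → Bool,
        n + 1 ≤ min (redEdges n c).card (blueEdges n c).card →
        ∀ r b : ℕ, r + b = 4 → K13K2Copy n c r b) ∧
    (∃ c : Sym2 (Fin n) → Bool,
        min (redEdges n c).card (blueEdges n c).card = n ∧ ¬ K13K2Copy n c 4 0) := by
  constructor
  · intro c hc r b hrb
    obtain ⟨hR, hB⟩ := le_min_iff.mp hc
    exact K13K2Copy_of_lt_card hn hR hB hrb
  · have : NeZero n := ⟨by omega⟩
    refine ⟨cycleColouring n, ?_, not_K13K2Copy_cycleColouring⟩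
    have hR := card_redEdges_cycleColouring (n := n) (by omega)
    have hsum := card_redEdges_add_card_blueEdges n (cycleColouring n)
    have hchoose : n * 2 ≤ n.choose 2 := by
      rw [Nat.choose_two_right, Nat.le_div_iff_mul_le two_pos, mul_assoc]
      exact Nat.mul_le_mul_left n (by omega)
    omega
end

section
/- For every integer n ≥ 10, every 2-edge-colouring of K_n in which the number of red edges satisfies |R| ≥ n+1 contains a copy of K_{1,3} ∪ K_2 all four of whose edges are red. -/
namespace SimpleGraph

/-- `G` contains no copy of `K_{1,3} ∪ K_2`. -/
def StarEdgeFree {V : Type*} (G : SimpleGraph V) : Prop :=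
  ∀ v a₁ a₂ a₃ x y : V, [v, a₁, a₂, a₃, x, y].Nodup →
    G.Adj v a₁ → G.Adj v a₂ → G.Adj v a₃ → ¬ G.Adj x y

variable {V : Type*} [Fintype V] [DecidableEq V] {G : SimpleGraph V} [DecidableRel G.Adj]

/-- An edge avoiding `v` leaves at most two neighbours of `v` uncovered. -/
lemma StarEdgeFree.card_sdiff_le (hG : G.StarEdgeFree) {v x y : V} (hxy : G.Adj x y)
    (hx : x ≠ v) (hy : y ≠ v) : (G.neighborFinset v \ {x, y}).card ≤ 2 := by
  by_contra! h
  obtain ⟨a, b, c, ha, hb, hc, hab, hac, hbc⟩ := Finset.two_lt_card_iff.mp h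
  simp only [Finset.mem_sdiff, mem_neighborFinset, Finset.mem_insert, Finset.mem_singleton,
    not_or] at ha hb hc
  refine hG v a b c x y ?_ ha.1 hb.1 hc.1 hxy
  have := ha.1.ne
  have := hb.1.ne
  have := hc.1.ne
  have := hxy.ne
  simp only [List.nodup_cons, List.mem_cons, List.not_mem_nil, or_false, not_or, not_false_eq_true,
    List.nodup_nil, and_true]
  grind

lemma StarEdgeFree.card_edgeFinset_lt_of_five_le (hG : G.StarEdgeFree) {v : V}
    (hv : 5 ≤ G.degree v) : G.edgeFinset.card < Fintype.card V := by
  have hsub : G.edgeFinset ⊆ G.incidenceFinset v := by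
    intro e he
    induction e with | _ x y
    rw [mem_edgeFinset, mem_edgeSet] at he
    rw [mem_incidenceFinset, mk'_mem_incidenceSet_iff]
    refine ⟨he, ?_⟩
    by_contra! h
    have h1 := hG.card_sdiff_le he h.1.symm h.2.symm
    have h2 := Finset.le_card_sdiff {x, y} (G.neighborFinset v)
    have h3 := Finset.card_le_two (a := x) (b := y)
    rw [card_neighborFinset_eq_degree] at h2
    omega
  calc G.edgeFinset.card ≤ (G.incidenceFinset v).card := Finset.card_le_card hsub
    _ = G.degree v := G.card_incidenceFinset_eq_degree v
    _ < Fintype.card V := G.degree_lt_card_verts v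

lemma StarEdgeFree.card_edgeFinset_le_of_degree_eq_four (hG : G.StarEdgeFree) {v : V}
    (hv : G.degree v = 4) : G.edgeFinset.card ≤ 10 := by
  set S := insert v (G.neighborFinset v) with hS
  have hcard : S.card = 5 := by
    rw [hS, Finset.card_insert_of_notMem (by simp), card_neighborFinset_eq_degree, hv]
  have hmem : ∀ x y, G.Adj x y → x ∈ S := by
    intro x y hxy
    by_contra hx
    simp only [hS, Finset.mem_insert, mem_neighborFinset, not_or] at hx
    have hy : y ≠ v := by
      rintro rfl
      exact hx.2 hxy.symm
    have h1 := hG.card_sdiff_le hxy hx.1 hy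
    rw [Finset.sdiff_insert_of_notMem (by simpa using hx.2)] at h1
    have h2 := Finset.le_card_sdiff {y} (G.neighborFinset v)
    rw [card_neighborFinset_eq_degree, Finset.card_singleton] at h2
    omega
  have hsub : G.edgeFinset ⊆ S.offDiag.image Sym2.mk.uncurry := by
    intro e he
    induction e with | _ x y
    rw [mem_edgeFinset, mem_edgeSet] at he
    exact Finset.mem_image.mpr
      ⟨(x, y), Finset.mem_offDiag.mpr ⟨hmem x y he, hmem y x he.symm, he.ne⟩, rfl⟩
  calc G.edgeFinset.card ≤ (S.offDiag.image Sym2.mk.uncurry).card := Finset.card_le_card hsub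
    _ = S.card.choose 2 := Sym2.card_image_offDiag S
    _ = 10 := by rw [hcard]; rfl

lemma StarEdgeFree.card_edgeFinset_le_of_degree_eq_three (hG : G.StarEdgeFree) {v : V}
    (hv : G.degree v = 3) (hmax : ∀ u, G.degree u ≤ 3) : G.edgeFinset.card ≤ 9 := by
  have hsub : G.edgeFinset ⊆ G.incidenceFinset v ∪
      (G.neighborFinset v).biUnion fun a => (G.incidenceFinset a).erase s(v, a) := by
    intro e he
    induction e with | _ x y
    rw [mem_edgeFinset, mem_edgeSet] at he
    simp only [Finset.mem_union, mem_incidenceFinset, mk'_mem_incidenceSet_iff, Finset.mem_biUnion,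
      Finset.mem_erase, mem_neighborFinset]
    by_contra! h
    have hvx : x ≠ v := fun h' => (h.1 he).1 h'.symm
    have hvy : y ≠ v := fun h' => (h.1 he).2 h'.symm
    have hx : ¬ G.Adj v x := fun h' =>
      (h.2 x h' (by simp [hvx, hvy]) he).1 rfl
    have hy : ¬ G.Adj v y := fun h' =>
      (h.2 y h' (by simp [hvx, hvy]) he).2 rfl
    have h1 := hG.card_sdiff_le he hvx hvy
    rw [Finset.sdiff_insert_of_notMem (by simpa using hx),
      Finset.sdiff_eq_self_of_disjoint (by simpa using hy), card_neighborFinset_eq_degree] at h1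
    omega
  have hbi := Finset.card_biUnion_le_card_mul (G.neighborFinset v)
    (fun a => (G.incidenceFinset a).erase s(v, a)) 2 fun a ha => by
      rw [mem_neighborFinset] at ha
      rw [Finset.card_erase_of_mem (by simp [mk'_mem_incidenceSet_iff, ha]),
        card_incidenceFinset_eq_degree]
      have := hmax a
      omega
  rw [card_neighborFinset_eq_degree, hv] at hbi
  have h1 := Finset.card_le_card hsub
  have h2 := Finset.card_union_le (G.incidenceFinset v)
    ((G.neighborFinset v).biUnion fun a => (G.incidenceFinset a).erase s(v, a))
  rw [card_incidenceFinset_eq_degree, hv] at h2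
  omega

/-- A `K_{1,3} ∪ K_2`-free graph on at least ten vertices has at most as many edges as vertices. -/
theorem StarEdgeFree.card_edgeFinset_le (hG : G.StarEdgeFree) (hV : 10 ≤ Fintype.card V) :
    G.edgeFinset.card ≤ Fintype.card V := by
  have : Nonempty V := Fintype.card_pos_iff.mp (by omega)
  obtain ⟨v, hv⟩ := G.exists_maximal_degree_vertex
  have hmax : ∀ u, G.degree u ≤ G.degree v := fun u => hv ▸ G.degree_le_maxDegree u
  obtain h | h | h | h :
      G.degree v ≤ 2 ∨ G.degree v = 3 ∨ G.degree v = 4 ∨ 5 ≤ G.degree v := by omega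
  · have hsum := G.sum_degrees_eq_twice_card_edges
    have hle := Finset.sum_le_card_nsmul Finset.univ (fun u => G.degree u) 2
      fun u _ => (hmax u).trans h
    rw [Finset.card_univ, smul_eq_mul] at hle
    omega
  · have := hG.card_edgeFinset_le_of_degree_eq_three h (h ▸ hmax)
    omega
  · have := hG.card_edgeFinset_le_of_degree_eq_four h
    omega
  · exact (hG.card_edgeFinset_lt_of_five_le h).le

end SimpleGraph

/-- For every `n ≥ 10`, every 2-edge-colouring of `K_n` with `|R| ≥ n+1` contains a copy of
`K_{1,3} ∪ K_2` (six distinct vertices: a star with centre `v` and leaves `a₁,a₂,a₃`,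
plus an independent edge `xy`) all four of whose edges are red. -/
theorem red_K13_union_K2 (n : ℕ) (hn : 10 ≤ n) (c : Sym2 (Fin n) → Bool)
    (hR : n + 1 ≤ (redEdges n c).card) :
    ∃ v a₁ a₂ a₃ x y : Fin n, ([v, a₁, a₂, a₃, x, y] : List (Fin n)).Nodup ∧
      c s(v, a₁) = true ∧ c s(v, a₂) = true ∧ c s(v, a₃) = true ∧ c s(x, y) = true := by
  classical
  by_contra! hno
  let G : SimpleGraph (Fin n) := SimpleGraph.fromEdgeSet {e | c e = true}
  have hG : G.StarEdgeFree := fun v a₁ a₂ a₃ x y hnd h₁ h₂ h₃ hxy =>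
    hno v a₁ a₂ a₃ x y hnd h₁.1 h₂.1 h₃.1 hxy.1
  have hE : redEdges n c = G.edgeFinset := by
    ext e
    induction e with | _ x y
    simp [redEdges, G, and_comm]
  have hle : (redEdges n c).card ≤ n := by
    rw [hE]
    convert hG.card_edgeFinset_le (by simpa using hn)
    simp
  omega
end

section
/- For every integer n ≥ 10, every 2-edge-colouring of K_n with min{|R|,|B|} ≥ n+1 contains a copy of K_{1,3} ∪ K_2 in which the star K_{1,3} has exactly two red edges and one blue edge and the edge of the vertex-disjoint K_2 is blue (hence a (2,2)-coloured copy). -/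
open Finset in
/-- In a graph with a vertex `v` that is adjacent to at least three, but not to all, other vertices,
and whose complement has more edges than vertices, some `K_{1,3} ∪ K_2` centred at `v` has
exactly two of its star edges in the graph and its two other edges in the complement. -/
theorem SimpleGraph.exists_star_union_edge_of_three_le_degree {V : Type*} [Fintype V]
    [DecidableEq V] (G : SimpleGraph V) [DecidableRel G.Adj] (hV : 7 ≤ Fintype.card V)
    (hB : Fintype.card V < #Gᶜ.edgeFinset) {v a : V} (hv : 3 ≤ G.degree v) (ha : Gᶜ.Adj v a) :
    ∃ a₁ a₂ a₃ x y, a₁ ≠ a₂ ∧ G.Adj v a₁ ∧ G.Adj v a₂ ∧ Gᶜ.Adj v a₃ ∧ Gᶜ.Adj x y ∧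
      x ∉ ({v, a₁, a₂, a₃} : Finset V) ∧ y ∉ ({v, a₁, a₂, a₃} : Finset V) := by
  by_contra! H
  have key : ∀ b x y, Gᶜ.Adj v b → Gᶜ.Adj x y → x ≠ v → y ≠ v → x ≠ b → y ≠ b →
      #(G.neighborFinset v \ {x, y}) ≤ 1 := by
    intro b x y hb hxy hxv hyv hxb hyb
    by_contra! hlt
    obtain ⟨p, hp, q, hq, hpq⟩ := one_lt_card.1 hlt
    simp only [mem_sdiff, mem_neighborFinset, mem_insert, mem_singleton, not_or] at hp hq
    exact hyv (by have := H p q b x y hpq hp.1 hq.1 hb hxy; grind)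
  have hdeg := G.degree_compl v
  have cover (S : Finset (Sym2 V))
      (hS : ∀ x y, Gᶜ.Adj x y → x ≠ v → y ≠ v → s(x, y) ∈ S) :
      #Gᶜ.edgeFinset ≤ Gᶜ.degree v + #S := by
    rw [← Gᶜ.card_incidenceFinset_eq_degree v]
    refine (card_le_card fun e he ↦ ?_).trans (card_union_le _ _)
    induction e with | h x y
    rw [mem_edgeFinset, mem_edgeSet] at he
    by_cases hx : x = v
    · subst hx; simp [incidenceSet, he]
    by_cases hy : y = v
    · subst hy; simp [incidenceSet, he]
    exact mem_union_right _ (hS x y he hx hy)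
  rcases hv.eq_or_lt with h3 | h4
  · obtain ⟨p, q, r, hpq, hpr, hqr, hN⟩ :=
      card_eq_three.1 ((G.card_neighborFinset_eq_degree v).trans h3.symm)
    have := cover {s(p, q), s(p, r), s(q, r)} fun x y hxy hxv hyv ↦ by
      obtain ⟨b, hb, hbxy⟩ : ∃ b ∈ Gᶜ.neighborFinset v, b ∉ ({x, y} : Finset V) := by
        refine exists_mem_notMem_of_card_lt_card ?_
        have := card_le_two (a := x) (b := y)
        rw [card_neighborFinset_eq_degree]
        omega
      rw [mem_neighborFinset] at hb
      have hk := key b x y hb hxy hxv hyv (by grind) (by grind)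
      have hne := hxy.ne
      rw [hN] at hk
      have hsub : ∀ s ∈ ({p, q, r} : Finset V), ∀ t ∈ ({p, q, r} : Finset V), s ≠ t →
          s ∈ ({x, y} : Finset V) ∨ t ∈ ({x, y} : Finset V) := by
        intro s hs t ht hst
        by_contra! hcon
        exact hst (card_le_one.1 hk s (mem_sdiff.2 ⟨hs, hcon.1⟩) t (mem_sdiff.2 ⟨ht, hcon.2⟩))
      have h₁ := hsub p (by simp) q (by simp) hpq
      have h₂ := hsub p (by simp) r (by simp) hpr
      have h₃ := hsub q (by simp) r (by simp) hqr
      simp only [mem_insert, mem_singleton, Sym2.eq_iff] at h₁ h₂ h₃ ⊢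
      grind
    have := card_le_three (a := s(p, q)) (b := s(p, r)) (c := s(q, r))
    omega
  · have hit : ∀ b x y, Gᶜ.Adj v b → Gᶜ.Adj x y → x ≠ v → y ≠ v → x = b ∨ y = b := by
      intro b x y hb hxy hxv hyv
      by_contra! hcon
      have := key b x y hb hxy hxv hyv hcon.1 hcon.2
      have := le_card_sdiff ({x, y} : Finset V) (G.neighborFinset v)
      have := card_le_two (a := x) (b := y)
      rw [card_neighborFinset_eq_degree] at *
      omega
    by_cases hb : ∃ b, Gᶜ.Adj v b ∧ b ≠ a
    · obtain ⟨b, hb, hba⟩ := hb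
      have := cover {s(a, b)} fun x y hxy hxv hyv ↦ by
        have h₁ := hit a x y ha hxy hxv hyv
        have h₂ := hit b x y hb hxy hxv hyv
        simp only [mem_singleton, Sym2.eq_iff]
        grind
      rw [card_singleton] at this
      omega
    · push Not at hb
      have h1 : Gᶜ.degree v ≤ 1 := by
        rw [← card_neighborFinset_eq_degree]
        refine card_le_one.2 fun s hs t ht ↦ ?_
        rw [mem_neighborFinset] at hs ht
        rw [hb s hs, hb t ht]
      have := cover (Gᶜ.incidenceFinset a) fun x y hxy hxv hyv ↦ by
        rcases hit a x y ha hxy hxv hyv with rfl | rfl <;> simp [incidenceSet, hxy]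
      rw [card_incidenceFinset_eq_degree] at this
      have := Gᶜ.degree_lt_card_verts a
      omega

open Finset in
/-- If a graph on at least seven vertices and its complement both have more edges than vertices, then
some `K_{1,3} ∪ K_2` has exactly two of its star edges in the graph and its two other edges in the
complement. -/
theorem SimpleGraph.exists_star_union_edge {V : Type*} [Fintype V] [DecidableEq V]
    (G : SimpleGraph V) [DecidableRel G.Adj] (hV : 7 ≤ Fintype.card V)
    (hR : Fintype.card V < #G.edgeFinset) (hB : Fintype.card V < #Gᶜ.edgeFinset) :
    ∃ v a₁ a₂ a₃ x y, a₁ ≠ a₂ ∧ G.Adj v a₁ ∧ G.Adj v a₂ ∧ Gᶜ.Adj v a₃ ∧ Gᶜ.Adj x y ∧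
      x ∉ ({v, a₁, a₂, a₃} : Finset V) ∧ y ∉ ({v, a₁, a₂, a₃} : Finset V) := by
  by_contra H
  have small : ∀ v a, Gᶜ.Adj v a → G.degree v ≤ 2 := by
    intro v a ha
    by_contra! hv
    exact H ⟨v, G.exists_star_union_edge_of_three_le_degree hV hB hv ha⟩
  obtain ⟨u, hu⟩ : ∃ u, 2 < G.degree u := by
    by_contra! hle
    have := G.sum_degrees_eq_twice_card_edges
    have := sum_le_card_nsmul univ (fun v ↦ G.degree v) 2 fun v _ ↦ hle v
    simp only [card_univ, smul_eq_mul] at this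
    omega
  have full : ∀ u, 2 < G.degree u → ∀ x, x ≠ u → G.Adj u x := by
    intro u hu x hx
    by_contra hux
    exact absurd (small u x ((G.compl_adj u x).2 ⟨hx.symm, hux⟩)) (by omega)
  obtain ⟨e, he, heu⟩ : ∃ e ∈ G.edgeFinset, e ∉ G.incidenceFinset u := by
    refine exists_mem_notMem_of_card_lt_card ?_
    have := G.degree_lt_card_verts u
    rw [card_incidenceFinset_eq_degree]
    omega
  have edge : ∃ v w, G.Adj v w ∧ v ≠ u ∧ w ≠ u ∧ G.degree v ≤ 2 := by
    induction e with | h v w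
    rw [mem_edgeFinset, mem_edgeSet] at he
    have hne : v ≠ u ∧ w ≠ u := by
      constructor <;> rintro rfl <;> simp [incidenceSet, he] at heu
    by_contra! hcon
    have hv := full v (hcon v w he hne.1 hne.2)
    have hw := full w (hcon w v he.symm hne.2 hne.1)
    obtain ⟨f, hf⟩ : Gᶜ.edgeFinset.Nonempty := card_pos.1 (by omega)
    induction f with | h s t
    rw [mem_edgeFinset, mem_edgeSet] at hf
    have hst := (G.compl_adj s t).1 hf
    have hu' := full u hu
    have hsu : s ≠ u := by rintro rfl; exact hst.2 (hu' t hst.1.symm)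
    have hsv : s ≠ v := by rintro rfl; exact hst.2 (hv t hst.1.symm)
    have hsw : s ≠ w := by rintro rfl; exact hst.2 (hw t hst.1.symm)
    have hsub : ({u, v, w} : Finset V) ⊆ G.neighborFinset s := by
      intro z hz
      rw [mem_neighborFinset]
      simp only [mem_insert, mem_singleton] at hz
      rcases hz with rfl | rfl | rfl
      exacts [(hu' s hsu).symm, (hv s hsv).symm, (hw s hsw).symm]
    have := card_le_card hsub
    rw [card_eq_three.2 ⟨u, v, w, hne.1.symm, hne.2.symm, he.ne, rfl⟩,
      card_neighborFinset_eq_degree] at this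
    have := small s t hf
    omega
  obtain ⟨v, w, hvw, hvu, hwu, hv⟩ := edge
  have huv : G.Adj v u := (full u hu v hvu).symm
  have hN : G.neighborFinset v = {u, w} := by
    refine (eq_of_subset_of_card_le ?_ ?_).symm
    · intro z hz
      simp only [mem_insert, mem_singleton] at hz
      rw [mem_neighborFinset]
      rcases hz with rfl | rfl <;> assumption
    · rwa [card_pair hwu.symm]
  have blue : ∀ z, z ∉ ({u, v, w} : Finset V) → Gᶜ.Adj v z := by
    intro z hz
    rw [compl_adj, ← mem_neighborFinset, hN]
    grind
  have hcard := card_le_three (a := u) (b := v) (c := w)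
  obtain ⟨x, -, hx⟩ : ∃ x ∈ univ, x ∉ ({u, v, w} : Finset V) :=
    exists_mem_notMem_of_card_lt_card (by rw [card_univ]; omega)
  have hxd := small x v (blue x hx).symm
  have hxu : G.Adj x u := (full u hu x (by grind)).symm
  obtain ⟨y, -, hy⟩ : ∃ y ∈ univ, y ∉ ({v, w, x} : Finset V) ∪ G.neighborFinset x := by
    refine exists_mem_notMem_of_card_lt_card ?_
    have := card_union_le ({v, w, x} : Finset V) (G.neighborFinset x)
    have := card_le_three (a := v) (b := w) (c := x)
    rw [card_neighborFinset_eq_degree] at *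
    rw [card_univ]
    omega
  simp only [mem_union, mem_neighborFinset, not_or] at hy
  have hyu : y ≠ u := by rintro rfl; exact hy.2 hxu
  obtain ⟨z, -, hz⟩ : ∃ z ∈ univ, z ∉ ({u, v, w} : Finset V) ∪ {x, y} := by
    refine exists_mem_notMem_of_card_lt_card ?_
    have := card_union_le ({u, v, w} : Finset V) {x, y}
    have := card_le_two (a := x) (b := y)
    rw [card_univ]
    omega
  refine H ⟨v, u, w, z, x, y, hwu.symm, huv, hvw, blue z (by grind),
    (G.compl_adj x y).2 ⟨by grind, hy.2⟩, by grind, by grind⟩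

/-- For every `n ≥ 10`, every 2-edge-colouring of `K_n` with `min{|R|,|B|} ≥ n+1` contains a
copy of `K_{1,3} ∪ K_2` (six distinct vertices: a star with centre `v` and leaves
`a₁,a₂,a₃`, plus an independent edge `xy`) in which the star has exactly two red edges and
one blue edge and the independent edge is blue — a `(2,2)`-coloured copy. -/
theorem balanced_22_K13_union_K2 (n : ℕ) (hn : 10 ≤ n) (c : Sym2 (Fin n) → Bool)
    (h : n + 1 ≤ min (redEdges n c).card (blueEdges n c).card) :
    ∃ v a₁ a₂ a₃ x y : Fin n, ([v, a₁, a₂, a₃, x, y] : List (Fin n)).Nodup ∧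
      c s(v, a₁) = true ∧ c s(v, a₂) = true ∧ c s(v, a₃) = false ∧ c s(x, y) = false := by
  classical
  obtain ⟨G, hG⟩ : ∃ G : SimpleGraph (Fin n), ∀ x y, G.Adj x y ↔ c s(x, y) = true ∧ x ≠ y :=
    ⟨SimpleGraph.fromEdgeSet {e | c e = true}, fun x y ↦ by simp⟩
  have hGc : ∀ x y, Gᶜ.Adj x y ↔ c s(x, y) = false ∧ x ≠ y := fun x y ↦ by
    rw [SimpleGraph.compl_adj, hG]; grind
  have hred : redEdges n c = G.edgeFinset := by
    ext e
    induction e with | h x y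
    simp [redEdges, hG, and_comm]
  have hblue : blueEdges n c = Gᶜ.edgeFinset := by
    ext e
    induction e with | h x y
    rw [SimpleGraph.mem_edgeFinset, SimpleGraph.mem_edgeSet, hGc]
    simp [blueEdges, and_comm]
  rw [hred, hblue, le_min_iff] at h
  obtain ⟨v, a₁, a₂, a₃, x, y, hne, h₁, h₂, h₃, hxy, hx, hy⟩ := G.exists_star_union_edge
    (by rw [Fintype.card_fin]; omega) (by rw [Fintype.card_fin]; omega)
    (by rw [Fintype.card_fin]; omega)
  rw [hG] at h₁ h₂
  rw [hGc] at h₃ hxy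
  refine ⟨v, a₁, a₂, a₃, x, y, ?_, h₁.1, h₂.1, h₃.1, hxy.1⟩
  grind
end

section
/- For every integer n ≥ 10, bal(n, 4K_2) = n−1; that is, every 2-edge-colouring of K_n with min{|R|,|B|} ≥ n contains a copy of 4K_2 with exactly two red and two blue edges, and there is a 2-edge-colouring of K_n with min{|R|,|B|} = n−1 containing no such copy. -/
/-- An `(r,b)`-coloured copy of `4K_2` in a 2-edge-coloured `K_n`: eight distinct vertices
forming four pairwise vertex-disjoint edges, exactly `r` of which are red and `b` blue. -/
def FourMatchingCopy (n : ℕ) (c : Sym2 (Fin n) → Bool) (r b : ℕ) : Prop :=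
  ∃ x₁ x₂ x₃ x₄ x₅ x₆ x₇ x₈ : Fin n,
    ([x₁, x₂, x₃, x₄, x₅, x₆, x₇, x₈] : List (Fin n)).Nodup ∧
    ((if c s(x₁, x₂) = true then 1 else 0) + (if c s(x₃, x₄) = true then 1 else 0) +
      (if c s(x₅, x₆) = true then 1 else 0) + (if c s(x₇, x₈) = true then 1 else 0) = r) ∧
    ((if c s(x₁, x₂) = false then 1 else 0) + (if c s(x₃, x₄) = false then 1 else 0) +
      (if c s(x₅, x₆) = false then 1 else 0) + (if c s(x₇, x₈) = false then 1 else 0) = b)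

/-- A family of at least `n ≥ 4` edges of `K_n` contains two disjoint edges. -/
theorem exists_disjoint_edges {n : ℕ} (hn : 4 ≤ n) (S : Finset (Sym2 (Fin n)))
    (hS : ∀ e ∈ S, ¬ e.IsDiag) (hcard : n ≤ S.card) :
    ∃ a b c d : Fin n, s(a, b) ∈ S ∧ s(c, d) ∈ S ∧ [a, b, c, d].Nodup := by
  by_contra! h
  have hne : ∀ a b : Fin n, s(a, b) ∈ S → a ≠ b := fun a b hab => by simpa using hS _ hab
  have meet : ∀ a b c d : Fin n, s(a, b) ∈ S → s(c, d) ∈ S →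
      a = c ∨ a = d ∨ b = c ∨ b = d := by
    intro a b c d hab hcd
    have h₁ := h a b c d hab hcd
    have h₂ := hne a b hab
    have h₃ := hne c d hcd
    simp only [List.nodup_cons, List.mem_cons, List.not_mem_nil] at h₁
    grind
  have star : ∀ a : Fin n, ∃ e ∈ S, a ∉ e := by
    intro a
    by_contra! ha
    have hsub : S ⊆ (Finset.univ.erase a).image (fun x => s(a, x)) := by
      intro e he
      obtain ⟨x, rfl⟩ := Sym2.mem_iff_exists.mp (ha e he)
      exact Finset.mem_image_of_mem _ (by simpa using (hne _ _ he).symm)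
    have h₁ := (Finset.card_le_card hsub).trans Finset.card_image_le
    rw [Finset.card_erase_of_mem (Finset.mem_univ a), Finset.card_univ, Fintype.card_fin] at h₁
    omega
  obtain ⟨e, he⟩ : S.Nonempty := Finset.card_pos.mp (by omega)
  induction e with | _ a b
  obtain ⟨e, hbc, hae⟩ := star a
  obtain ⟨c, rfl⟩ : ∃ c, e = s(b, c) := by
    induction e with | _ p q
    have := meet a b p q he hbc
    simp only [Sym2.mem_iff] at hae
    exact Sym2.mem_iff_exists.mp (by simp only [Sym2.mem_iff]; grind)
  obtain ⟨e, hac, hbe⟩ := star b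
  obtain rfl : e = s(a, c) := by
    induction e with | _ p q
    have h₁ := meet a b p q he hac
    have h₂ := meet b c p q hbc hac
    have h₃ := hne _ _ hac
    simp only [Sym2.mem_iff] at hae hbe
    rw [Sym2.eq_iff]
    grind
  have hsub : S ⊆ {s(a, b), s(b, c), s(a, c)} := by
    intro e h₀
    induction e with | _ p q
    have h₁ := meet a b p q he h₀
    have h₂ := meet b c p q hbc h₀
    have h₃ := meet a c p q hac h₀
    have h₄ := hne _ _ h₀
    simp only [Finset.mem_insert, Finset.mem_singleton, Sym2.eq_iff]
    grind
  have := (Finset.card_le_card hsub).trans Finset.card_le_three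
  omega

/-- A property of permutations invariant under right multiplication by the transpositions
`swap i k`, for a fixed `k`, holds for all permutations or for none. -/
theorem perm_iff_of_star_swap_invariant {α : Type*} [Finite α] [DecidableEq α] (k : α)
    (P : Equiv.Perm α → Prop) (h : ∀ σ i, P (σ * Equiv.swap i k) ↔ P σ)
    (σ τ : Equiv.Perm α) : P σ ↔ P τ := by
  have swap_inv : ∀ (σ : Equiv.Perm α) (i j : α), i ≠ j → (P (σ * Equiv.swap i j) ↔ P σ) := by
    intro σ i j hij
    by_cases hik : i = k
    · rw [hik, Equiv.swap_comm, h]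
    by_cases hjk : j = k
    · rw [hjk, h]
    have : Equiv.swap i j = Equiv.swap i k * Equiv.swap j k * Equiv.swap i k := by
      rw [Equiv.swap_comm i k, Equiv.swap_mul_swap_mul_swap hjk hij.symm]
    rw [this, ← mul_assoc, ← mul_assoc, h, h, h]
  have all_iff_one : ∀ σ : Equiv.Perm α, P σ ↔ P 1 := by
    intro σ
    induction σ using Equiv.Perm.swap_induction_on' with
    | one => rfl
    | mul_swap f x y hxy ih => rw [swap_inv f x y hxy, ih]
  rw [all_iff_one σ, all_iff_one τ]

/-- Four prescribed distinct values of a permutation on four distinct points. -/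
theorem exists_perm_of_four {n : ℕ} (i j : Fin 4 → Fin n) (hi : Function.Injective i)
    (hj : Function.Injective j) : ∃ σ : Equiv.Perm (Fin n), ∀ t, σ (i t) = j t := by
  obtain ⟨σ, hσ⟩ := (Equiv.Perm.isMultiplyPretransitive (Fin n) 4).exists_smul_eq ⟨i, hi⟩ ⟨j, hj⟩
  exact ⟨σ, fun t => DFunLike.congr_fun hσ t⟩

/-- The number of red edges in the matching `σ(v₀)σ(v₁), …, σ(v₆)σ(v₇)`. -/
def redCount {n : ℕ} (c : Sym2 (Fin n) → Bool) (v : Fin 9 → Fin n)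
    (σ : Equiv.Perm (Fin n)) : ℕ :=
  (if c s(σ (v 0), σ (v 1)) = true then 1 else 0) +
    (if c s(σ (v 2), σ (v 3)) = true then 1 else 0) +
    (if c s(σ (v 4), σ (v 5)) = true then 1 else 0) +
    (if c s(σ (v 6), σ (v 7)) = true then 1 else 0)

theorem redCount_mul_swap {n : ℕ} (c : Sym2 (Fin n) → Bool) (v : Fin 9 → Fin n)
    (hv : Function.Injective v) (σ : Equiv.Perm (Fin n)) (i : Fin n) :
    redCount c v (σ * Equiv.swap i (v 8)) ≤ redCount c v σ + 1 ∧
      redCount c v σ ≤ redCount c v (σ * Equiv.swap i (v 8)) + 1 := by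
  have fixed : ∀ t : Fin 9, t ≠ 8 → v t ≠ i →
      (σ * Equiv.swap i (v 8)) (v t) = σ (v t) := fun t ht hti => by
    rw [Equiv.Perm.mul_apply, Equiv.swap_apply_of_ne_of_ne hti (hv.ne ht)]
  by_cases hi : ∃ t, v t = i
  · obtain ⟨t, rfl⟩ := hi
    have fixed' : ∀ s : Fin 9, s ≠ 8 → s ≠ t →
        (σ * Equiv.swap (v t) (v 8)) (v s) = σ (v s) := fun s hs hst =>
      fixed s hs (hv.ne hst)
    generalize σ * Equiv.swap (v t) (v 8) = τ at *
    unfold redCount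
    fin_cases t <;> simp [fixed'] <;> split_ifs <;> omega
  · push Not at hi
    simp [redCount, fixed _ _ (hi _)]

theorem fourMatchingCopy_of_redCount_eq_two {n : ℕ} (c : Sym2 (Fin n) → Bool) (v : Fin 9 → Fin n)
    (hv : Function.Injective v) (σ : Equiv.Perm (Fin n)) (h : redCount c v σ = 2) :
    FourMatchingCopy n c 2 2 := by
  refine ⟨σ (v 0), σ (v 1), σ (v 2), σ (v 3), σ (v 4), σ (v 5), σ (v 6), σ (v 7), ?_, h, ?_⟩
  · simp [hv.eq_iff]
  · unfold redCount at h
    simp only [← Bool.not_eq_true]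
    split_ifs at h ⊢ <;> omega

theorem exists_fourMatchingCopy {n : ℕ} (hn : 10 ≤ n) (c : Sym2 (Fin n) → Bool)
    (h : n ≤ min (redEdges n c).card (blueEdges n c).card) : FourMatchingCopy n c 2 2 := by
  let v : Fin 9 → Fin n := Fin.castLE (by omega)
  have hv : Function.Injective v := Fin.castLE_injective _
  let i : Fin 4 → Fin n := fun t => v (Fin.castLE (by omega) t)
  have hi : Function.Injective i := hv.comp (Fin.castLE_injective _)
  have key : ∀ S : Finset (Sym2 (Fin n)), (∀ e ∈ S, ¬ e.IsDiag) → n ≤ S.card →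
      ∃ σ : Equiv.Perm (Fin n), s(σ (v 0), σ (v 1)) ∈ S ∧ s(σ (v 2), σ (v 3)) ∈ S := by
    intro S hS hcard
    obtain ⟨p, q, r, s, hpq, hrs, hnd⟩ := exists_disjoint_edges (by omega) S hS hcard
    obtain ⟨σ, hσ⟩ := exists_perm_of_four i [p, q, r, s].get hi
      (List.nodup_iff_injective_get.mp hnd)
    have h₀ : σ (v 0) = p := hσ 0
    have h₁ : σ (v 1) = q := hσ 1
    have h₂ : σ (v 2) = r := hσ 2
    have h₃ : σ (v 3) = s := hσ 3
    exact ⟨σ, by rwa [h₀, h₁], by rwa [h₂, h₃]⟩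
  obtain ⟨ρ, hρ₁, hρ₂⟩ := key (redEdges n c) (by simp +contextual [redEdges])
    (h.trans (min_le_left _ _))
  obtain ⟨β, hβ₁, hβ₂⟩ := key (blueEdges n c) (by simp +contextual [blueEdges])
    (h.trans (min_le_right _ _))
  by_contra hno
  have ne_two : ∀ σ, redCount c v σ ≠ 2 := fun σ hσ =>
    hno (fourMatchingCopy_of_redCount_eq_two c v hv σ hσ)
  have hiff := perm_iff_of_star_swap_invariant (v 8) (fun σ => 3 ≤ redCount c v σ)
    (fun σ i => by
      have := redCount_mul_swap c v hv σ i
      have := ne_two σ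
      have := ne_two (σ * Equiv.swap i (v 8))
      omega) ρ β
  have hρ := ne_two ρ
  have hβ := ne_two β
  simp only [redEdges, blueEdges, Finset.mem_filter] at hρ₁ hρ₂ hβ₁ hβ₂
  simp only [redCount, hρ₁.2, hρ₂.2, hβ₁.2, hβ₂.2] at hiff hρ hβ
  grind

theorem card_redEdges_star {n : ℕ} (z : Fin n) :
    (redEdges n fun e => decide (z ∈ e)).card = n - 1 := by
  have : redEdges n (fun e => decide (z ∈ e)) = (⊤ : SimpleGraph (Fin n)).incidenceFinset z := by
    ext e
    simp [redEdges, SimpleGraph.incidenceSet]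
  rw [this, SimpleGraph.card_incidenceFinset_eq_degree, SimpleGraph.complete_graph_degree,
    Fintype.card_fin]

theorem not_fourMatchingCopy_star {n : ℕ} (z : Fin n) :
    ¬ FourMatchingCopy n (fun e => decide (z ∈ e)) 2 2 := by
  rintro ⟨a, b, c, d, e, f, g, h, hnd, hred, -⟩
  simp only [decide_eq_true_eq, Sym2.mem_iff] at hred
  simp only [List.nodup_cons, List.mem_cons, List.not_mem_nil] at hnd
  grind

/-- For every `n ≥ 10`, `bal(n, 4K_2) = n - 1`: every 2-edge-colouring of `K_n` with
`min{|R|,|B|} ≥ n` contains a copy of `4K_2` with exactly two red and two blue edges, and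
there is a 2-edge-colouring with `min{|R|,|B|} = n - 1` containing no such copy. -/
theorem bal_four_matching (n : ℕ) (hn : 10 ≤ n) :
    (∀ c : Sym2 (Fin n) → Bool,
        n ≤ min (redEdges n c).card (blueEdges n c).card → FourMatchingCopy n c 2 2) ∧
    (∃ c : Sym2 (Fin n) → Bool,
        min (redEdges n c).card (blueEdges n c).card = n - 1 ∧
        ¬ FourMatchingCopy n c 2 2) := by
  refine ⟨fun c => exists_fourMatchingCopy hn c, ?_⟩
  let z : Fin n := ⟨0, by omega⟩
  refine ⟨fun e => decide (z ∈ e), ?_, not_fourMatchingCopy_star z⟩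
  have hsum := card_redEdges_add_card_blueEdges n fun e => decide (z ∈ e)
  have hchoose : 2 * (n - 1) ≤ n.choose 2 := by
    rw [Nat.choose_two_right, Nat.le_div_iff_mul_le two_pos]
    nlinarith
  rw [card_redEdges_star] at hsum ⊢
  exact min_eq_left (by omega)
end

section
/- For every integer n ≥ 8, bal(n, 2K_2 ∪ K_{1,2}) = 1; that is, every 2-edge-colouring of K_n with min{|R|,|B|} ≥ 2 contains a copy of 2K_2 ∪ K_{1,2} with exactly two red and two blue edges, and there is a 2-edge-colouring of K_n with min{|R|,|B|} = 1 containing no such copy. -/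
/-- An `(r,b)`-coloured copy of `2K_2 ∪ K_{1,2}` in a 2-edge-coloured `K_n`: seven distinct
vertices giving two independent edges `x₁x₂`, `x₃x₄` and a path `K_{1,2}` with centre `w`
and leaves `p, q`, with exactly `r` red edges and `b` blue edges among the four edges. -/
def TwoK2K12Copy (n : ℕ) (c : Sym2 (Fin n) → Bool) (r b : ℕ) : Prop :=
  ∃ x₁ x₂ x₃ x₄ w p q : Fin n,
    ([x₁, x₂, x₃, x₄, w, p, q] : List (Fin n)).Nodup ∧
    ((if c s(x₁, x₂) = true then 1 else 0) + (if c s(x₃, x₄) = true then 1 else 0) +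
      (if c s(w, p) = true then 1 else 0) + (if c s(w, q) = true then 1 else 0) = r) ∧
    ((if c s(x₁, x₂) = false then 1 else 0) + (if c s(x₃, x₄) = false then 1 else 0) +
      (if c s(w, p) = false then 1 else 0) + (if c s(w, q) = false then 1 else 0) = b)

section TwoK2K12

variable {n : ℕ} {c : Sym2 (Fin n) → Bool}

theorem exists_notMem_list_fin (l : List (Fin n)) (hl : l.length < n) : ∃ x, x ∉ l := by
  by_contra! h
  have h1 : l.toFinset = Finset.univ := by ext; simp [h]
  have h2 := l.toFinset_card_le
  simp [h1] at h2
  omega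

/-- If any two edges sharing a vertex inside `U` have the same colour, then all edges inside `U`
have the same colour. -/
theorem edges_eq_of_adjacent_eq {U : Fin n → Prop}
    (h : ∀ x y z, U x → U y → U z → [x, y, z].Nodup → c s(x, y) = c s(x, z))
    {x y u v : Fin n} (hx : U x) (hy : U y) (hu : U u) (hv : U v) (hxy : x ≠ y) (huv : u ≠ v) :
    c s(x, y) = c s(u, v) := by
  have h' : ∀ x y z, U x → U y → U z → x ≠ y → x ≠ z → c s(x, y) = c s(x, z) := by
    intro x y z hx hy hz hxy hxz
    by_cases hyz : y = z
    · rw [hyz]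
    · exact h x y z hx hy hz (by simp [hxy, hxz, hyz])
  by_cases hxu : x = u
  · subst hxu
    exact h' x y v hx hy hv hxy huv
  · rw [h' x y u hx hy hu hxy hxu, Sym2.eq_swap, h' u x v hu hx hv (Ne.symm hxu) huv]

theorem twoK2K12Copy_of_mixed {x₁ x₂ x₃ x₄ w p q : Fin n}
    (hd : [x₁, x₂, x₃, x₄, w, p, q].Nodup)
    (h₁ : c s(x₁, x₂) ≠ c s(x₃, x₄)) (h₂ : c s(w, p) ≠ c s(w, q)) :
    TwoK2K12Copy n c 2 2 := by
  refine ⟨x₁, x₂, x₃, x₄, w, p, q, hd, ?_, ?_⟩ <;>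
  cases h1 : c s(x₁, x₂) <;> cases h2 : c s(x₃, x₄) <;> cases h3 : c s(w, p) <;>
    cases h4 : c s(w, q) <;> simp_all

theorem twoK2K12Copy_of_matching_ne_cherry {x₁ x₂ x₃ x₄ w p q : Fin n} {k : Bool}
    (hd : [x₁, x₂, x₃, x₄, w, p, q].Nodup)
    (h₁ : c s(x₁, x₂) ≠ k) (h₂ : c s(x₃, x₄) ≠ k) (h₃ : c s(w, p) = k) (h₄ : c s(w, q) = k) :
    TwoK2K12Copy n c 2 2 := by
  refine ⟨x₁, x₂, x₃, x₄, w, p, q, hd, ?_, ?_⟩ <;> cases k <;> simp_all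

theorem exists_mixed_cherry {a b a' b' : Fin n} (hab : a ≠ b) (huv : a' ≠ b')
    (h : c s(a, b) ≠ c s(a', b')) :
    ∃ w p q, [w, p, q].Nodup ∧ c s(w, p) ≠ c s(w, q) := by
  by_contra! hno
  exact h (edges_eq_of_adjacent_eq (U := fun _ => True) (fun x y z _ _ _ hd => hno x y z hd)
    trivial trivial trivial trivial hab huv)

/-- Outside a mixed cherry, a colouring without balanced copies is monochromatic. -/
theorem monochromatic_off_mixed_cherry (hn : 8 ≤ n) (hc : ¬ TwoK2K12Copy n c 2 2)
    {w p q : Fin n} (hd : [w, p, q].Nodup) (hw : c s(w, p) ≠ c s(w, q)) :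
    ∃ k, ∀ x y, x ∉ [w, p, q] → y ∉ [w, p, q] → x ≠ y → c s(x, y) = k := by
  obtain ⟨u, hu⟩ := exists_notMem_list_fin [w, p, q] (by simp; omega)
  obtain ⟨v, hv⟩ := exists_notMem_list_fin [u, w, p, q] (by simp; omega)
  refine ⟨c s(u, v), fun x y hx hy hxy => edges_eq_of_adjacent_eq (U := (· ∉ [w, p, q]))
    ?_ hx hy hu (fun h => hv (List.mem_cons_of_mem _ h)) hxy (fun h => hv (by simp [h]))⟩
  intro x y z hx hy hz hxyz
  obtain ⟨a, ha⟩ := exists_notMem_list_fin [x, y, z, w, p, q] (by simp; omega)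
  obtain ⟨b, hb⟩ := exists_notMem_list_fin [a, x, y, z, w, p, q] (by simp; omega)
  by_contra hne
  by_cases h : c s(x, y) = c s(a, b)
  · exact hc (twoK2K12Copy_of_mixed (x₁ := x) (x₂ := z) (x₃ := a) (x₄ := b)
      (by simp at *; grind) (fun h' => hne (h.trans h'.symm)) hw)
  · exact hc (twoK2K12Copy_of_mixed (x₁ := x) (x₂ := y) (x₃ := a) (x₄ := b)
      (by simp at *; grind) h hw)

theorem twoK2K12Copy_of_matching_of_mem (hn : 8 ≤ n) {w p q : Fin n} {k : Bool}
    (hk : ∀ x y, x ∉ [w, p, q] → y ∉ [w, p, q] → x ≠ y → c s(x, y) = k)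
    {a b d e : Fin n} (hd : [a, b, d, e].Nodup) (ha : a ∈ [w, p, q]) (hd' : d ∈ [w, p, q])
    (hab : c s(a, b) ≠ k) (hde : c s(d, e) ≠ k) : TwoK2K12Copy n c 2 2 := by
  obtain ⟨x, hx⟩ := exists_notMem_list_fin [b, e, w, p, q] (by simp; omega)
  obtain ⟨y, hy⟩ := exists_notMem_list_fin [x, b, e, w, p, q] (by simp; omega)
  obtain ⟨z, hz⟩ := exists_notMem_list_fin [y, x, b, e, w, p, q] (by simp; omega)
  refine twoK2K12Copy_of_matching_ne_cherry (x₁ := a) (x₂ := b) (x₃ := d) (x₄ := e)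
    (w := x) (p := y) (q := z) ?_ hab hde (hk _ _ ?_ ?_ ?_) (hk _ _ ?_ ?_ ?_) <;>
  · simp at *
    grind

theorem twoK2K12Copy_of_matching (hn : 8 ≤ n) {w p q : Fin n} {k : Bool}
    (hk : ∀ x y, x ∉ [w, p, q] → y ∉ [w, p, q] → x ≠ y → c s(x, y) = k)
    {a b d e : Fin n} (hd : [a, b, d, e].Nodup)
    (hab : c s(a, b) ≠ k) (hde : c s(d, e) ≠ k) : TwoK2K12Copy n c 2 2 := by
  have hab' : a ∈ [w, p, q] ∨ b ∈ [w, p, q] := by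
    by_contra! h
    exact hab (hk a b h.1 h.2 (by simp at hd; tauto))
  have hde' : d ∈ [w, p, q] ∨ e ∈ [w, p, q] := by
    by_contra! h
    exact hde (hk d e h.1 h.2 (by simp at hd; tauto))
  have hba : c s(b, a) ≠ k := by rwa [Sym2.eq_swap]
  have hed : c s(e, d) ≠ k := by rwa [Sym2.eq_swap]
  rcases hab' with h | h <;> rcases hde' with h' | h'
  · exact twoK2K12Copy_of_matching_of_mem hn hk hd h h' hab hde
  · exact twoK2K12Copy_of_matching_of_mem hn hk (by simp at *; grind) h h' hab hed
  · exact twoK2K12Copy_of_matching_of_mem hn hk (by simp at *; grind) h h' hba hde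
  · exact twoK2K12Copy_of_matching_of_mem hn hk (by simp at *; grind) h h' hba hed

theorem twoK2K12Copy_of_cherry (hn : 8 ≤ n) {w p q : Fin n} {k : Bool}
    (hk : ∀ x y, x ∉ [w, p, q] → y ∉ [w, p, q] → x ≠ y → c s(x, y) = k)
    {a b d : Fin n} (hd : [a, b, d].Nodup)
    (hab : c s(a, b) ≠ k) (had : c s(a, d) ≠ k) : TwoK2K12Copy n c 2 2 := by
  obtain ⟨x, hx⟩ := exists_notMem_list_fin [a, b, d] (by simp; omega)
  obtain ⟨y, hy⟩ := exists_notMem_list_fin [x, a, b, d] (by simp; omega)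
  obtain ⟨z, hz⟩ := exists_notMem_list_fin [y, x, a, b, d] (by simp; omega)
  obtain ⟨t, ht⟩ := exists_notMem_list_fin [z, y, x, a, b, d] (by simp; omega)
  by_cases hxy : c s(x, y) = k
  · by_cases hzt : c s(z, t) = k
    · refine twoK2K12Copy_of_matching_ne_cherry (x₁ := x) (x₂ := y) (x₃ := z) (x₄ := t)
        (w := a) (p := b) (q := d) (k := !k) (by simp at *; grind) ?_ ?_ ?_ ?_ <;>
        cases k <;> simp_all
    · exact twoK2K12Copy_of_matching hn hk (by simp at *; grind) hab hzt
  · exact twoK2K12Copy_of_matching hn hk (by simp at *; grind) hab hxy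

theorem twoK2K12Copy_of_two_edges (hn : 8 ≤ n) {w p q : Fin n} {k : Bool}
    (hk : ∀ x y, x ∉ [w, p, q] → y ∉ [w, p, q] → x ≠ y → c s(x, y) = k)
    {a b d e : Fin n} (hab : a ≠ b) (hde : d ≠ e) (hne : s(a, b) ≠ s(d, e))
    (h : c s(a, b) ≠ k) (h' : c s(d, e) ≠ k) : TwoK2K12Copy n c 2 2 := by
  have hba : c s(b, a) ≠ k := by rwa [Sym2.eq_swap]
  have hed : c s(e, d) ≠ k := by rwa [Sym2.eq_swap]
  simp only [ne_eq, Sym2.eq_iff, not_or, not_and] at hne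
  by_cases h1 : a = d
  · subst h1
    exact twoK2K12Copy_of_cherry hn hk (by simp; grind) h h'
  by_cases h2 : a = e
  · subst h2
    exact twoK2K12Copy_of_cherry hn hk (by simp; grind) h hed
  by_cases h3 : b = d
  · subst h3
    exact twoK2K12Copy_of_cherry hn hk (by simp; grind) hba h'
  by_cases h4 : b = e
  · subst h4
    exact twoK2K12Copy_of_cherry hn hk (by simp; grind) hba hed
  exact twoK2K12Copy_of_matching hn hk (by simp; grind) h h'

theorem twoK2K12Copy_of_two_le (hn : 8 ≤ n) (hr : 1 < (redEdges n c).card)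
    (hb : 1 < (blueEdges n c).card) : TwoK2K12Copy n c 2 2 := by
  by_contra hc
  obtain ⟨r, hr, r', hr', hrne⟩ := Finset.one_lt_card.1 hr
  obtain ⟨b, hb, b', hb', hbne⟩ := Finset.one_lt_card.1 hb
  induction r with | _ r₁ r₂
  induction r' with | _ r₁' r₂'
  induction b with | _ b₁ b₂
  induction b' with | _ b₁' b₂'
  simp only [redEdges, blueEdges, Finset.mem_filter, SimpleGraph.mem_edgeFinset,
    SimpleGraph.mem_edgeSet, SimpleGraph.top_adj] at hr hr' hb hb'
  obtain ⟨w, p, q, hd, hw⟩ := exists_mixed_cherry (c := c) hr.1 hb.1 (by simp [hr.2, hb.2])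
  obtain ⟨k, hk⟩ := monochromatic_off_mixed_cherry hn hc hd hw
  cases k
  · exact hc (twoK2K12Copy_of_two_edges hn hk hr.1 hr'.1 hrne (by simp [hr.2]) (by simp [hr'.2]))
  · exact hc (twoK2K12Copy_of_two_edges hn hk hb.1 hb'.1 hbne (by simp [hb.2]) (by simp [hb'.2]))

theorem not_twoK2K12Copy_decide_eq (e : Sym2 (Fin n)) :
    ¬ TwoK2K12Copy n (fun f => decide (f = e)) 2 2 := by
  rintro ⟨x₁, x₂, x₃, x₄, w, p, q, hd, h, -⟩
  have h₁ : s(x₁, x₂) ≠ s(x₃, x₄) := by simp at *; grind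
  have h₂ : s(x₁, x₂) ≠ s(w, p) := by simp at *; grind
  have h₃ : s(x₁, x₂) ≠ s(w, q) := by simp at *; grind
  have h₄ : s(x₃, x₄) ≠ s(w, p) := by simp at *; grind
  have h₅ : s(x₃, x₄) ≠ s(w, q) := by simp at *; grind
  have h₆ : s(w, p) ≠ s(w, q) := by simp at *; grind
  simp only [decide_eq_true_eq] at h
  grind

theorem min_card_decide_eq {a b d : Fin n} (hd : [a, b, d].Nodup) :
    min (redEdges n (fun f => decide (f = s(a, b)))).card
      (blueEdges n (fun f => decide (f = s(a, b)))).card = 1 := by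
  have hr : redEdges n (fun f => decide (f = s(a, b))) = {s(a, b)} := by
    ext f
    simp only [redEdges, Finset.mem_filter, SimpleGraph.mem_edgeFinset, decide_eq_true_eq,
      Finset.mem_singleton, and_iff_right_iff_imp]
    rintro rfl
    simp at *
    tauto
  have hb : s(a, d) ∈ blueEdges n (fun f => decide (f = s(a, b))) := by
    simp [blueEdges] at *
    grind
  rw [hr, Finset.card_singleton]
  exact min_eq_left (Finset.card_pos.2 ⟨_, hb⟩)

end TwoK2K12

/-- For every `n ≥ 8`, `bal(n, 2K_2 ∪ K_{1,2}) = 1`: every 2-edge-colouring of `K_n` with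
`min{|R|,|B|} ≥ 2` contains a copy of `2K_2 ∪ K_{1,2}` with exactly two red and two blue
edges, and there is a 2-edge-colouring with `min{|R|,|B|} = 1` containing no such copy. -/
theorem bal_twoK2_union_K12 (n : ℕ) (hn : 8 ≤ n) :
    (∀ c : Sym2 (Fin n) → Bool,
        2 ≤ min (redEdges n c).card (blueEdges n c).card → TwoK2K12Copy n c 2 2) ∧
    (∃ c : Sym2 (Fin n) → Bool,
        min (redEdges n c).card (blueEdges n c).card = 1 ∧ ¬ TwoK2K12Copy n c 2 2) := by
  refine ⟨fun c hc => ?_, fun f => decide (f = s(⟨0, by omega⟩, ⟨1, by omega⟩)),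
    min_card_decide_eq (a := ⟨0, by omega⟩) (b := ⟨1, by omega⟩) (d := ⟨2, by omega⟩)
      (by simp), not_twoK2K12Copy_decide_eq _⟩
  obtain ⟨hr, hb⟩ := le_min_iff.1 hc
  exact twoK2K12Copy_of_two_le hn hr hb
end

section
/- For every integer n ≥ 7, bal(n, K_2 ∪ K_3) = 3; that is, every 2-edge-colouring of K_n with min{|R|,|B|} ≥ 4 contains a copy of K_2 ∪ K_3 with exactly two red and two blue edges, and there is a 2-edge-colouring of K_n with min{|R|,|B|} = 3 containing no such copy. -/
/-- An `(r,b)`-coloured copy of `K_2 ∪ K_3` in a 2-edge-coloured `K_n`: five distinct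
vertices giving an edge `xy` and a vertex-disjoint triangle `a₁a₂a₃`, with exactly `r` red
edges and `b` blue edges among the four edges. -/
def K2K3Copy (n : ℕ) (c : Sym2 (Fin n) → Bool) (r b : ℕ) : Prop :=
  ∃ x y a₁ a₂ a₃ : Fin n,
    ([x, y, a₁, a₂, a₃] : List (Fin n)).Nodup ∧
    ((if c s(x, y) = true then 1 else 0) + (if c s(a₁, a₂) = true then 1 else 0) +
      (if c s(a₂, a₃) = true then 1 else 0) + (if c s(a₁, a₃) = true then 1 else 0) = r) ∧
    ((if c s(x, y) = false then 1 else 0) + (if c s(a₁, a₂) = false then 1 else 0) +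
      (if c s(a₂, a₃) = false then 1 else 0) + (if c s(a₁, a₃) = false then 1 else 0) = b)

theorem exists_notMem_of_card_lt {n : ℕ} (S : Finset (Fin n)) (h : S.card < n) :
    ∃ v, v ∉ S := by
  by_contra! hS
  have := Finset.card_le_card (fun v _ => hS v : Finset.univ ⊆ S)
  simp at this
  omega

theorem K2K3Copy.of_colours {n : ℕ} {c : Sym2 (Fin n) → Bool} (t : Bool) {x y a b d : Fin n}
    (hnd : ([x, y, a, b, d] : List (Fin n)).Nodup) (hxy : c s(x, y) = t) (hab : c s(a, b) = t)
    (hbd : c s(b, d) = !t) (had : c s(a, d) = !t) : K2K3Copy n c 2 2 := by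
  refine ⟨x, y, a, b, d, hnd, ?_⟩
  cases t <;> simp_all

/-- The triangle `abd` has exactly one edge of colour `t`, namely `ab`. -/
def UniqueColourTriangle {n : ℕ} (c : Sym2 (Fin n) → Bool) (t : Bool) (a b d : Fin n) : Prop :=
  ([a, b, d] : List (Fin n)).Nodup ∧ c s(a, b) = t ∧ c s(b, d) = !t ∧ c s(a, d) = !t

theorem UniqueColourTriangle.copy_of_opposite {n : ℕ} (hn : 7 ≤ n) {c : Sym2 (Fin n) → Bool}
    {a b d a' b' d' : Fin n} (hT : UniqueColourTriangle c true a b d)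
    (hT' : UniqueColourTriangle c false a' b' d') : K2K3Copy n c 2 2 := by
  obtain ⟨hnd, hab, hbd, had⟩ := hT
  obtain ⟨hnd', hab', hbd', had'⟩ := hT'
  by_cases hdisj : a' ∉ ({a, b, d} : Finset (Fin n)) ∧ d' ∉ ({a, b, d} : Finset (Fin n))
  · refine K2K3Copy.of_colours true (x := a') (y := d') (a := a) (b := b) (d := d)
      ?_ had' hab hbd had
    simp at hdisj hnd hnd' ⊢
    tauto
  · have hcard : (({a, b, d} : Finset (Fin n)) ∪ {a', b', d'}).card ≤ 5 := by
      have h1 := Finset.card_union_add_card_inter ({a, b, d} : Finset (Fin n)) {a', b', d'}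
      have h2 := Finset.card_le_three (a := a) (b := b) (c := d)
      have h3 := Finset.card_le_three (a := a') (b := b') (c := d')
      have h4 : 0 < (({a, b, d} : Finset (Fin n)) ∩ {a', b', d'}).card := by
        rw [Finset.card_pos]
        by_cases ha : a' ∈ ({a, b, d} : Finset (Fin n))
        · exact ⟨a', Finset.mem_inter.2 ⟨ha, by simp⟩⟩
        · exact ⟨d', Finset.mem_inter.2 ⟨by tauto, by simp⟩⟩
      omega
    obtain ⟨x, hx⟩ := exists_notMem_of_card_lt (({a, b, d} : Finset (Fin n)) ∪ {a', b', d'})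
      (by omega)
    obtain ⟨y, hy⟩ := exists_notMem_of_card_lt
      (insert x (({a, b, d} : Finset (Fin n)) ∪ {a', b', d'}))
      (by have := Finset.card_insert_le x (({a, b, d} : Finset (Fin n)) ∪ {a', b', d'}); omega)
    simp only [Finset.mem_insert, Finset.mem_union, Finset.mem_singleton, not_or] at hx hy
    cases hxy : c s(x, y)
    · refine K2K3Copy.of_colours false (x := x) (y := y) (a := a') (b := b') (d := d')
        ?_ hxy hab' hbd' had'
      simp at hnd' ⊢
      grind
    · refine K2K3Copy.of_colours true (x := x) (y := y) (a := a) (b := b) (d := d)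
        ?_ hxy hab hbd had
      simp at hnd ⊢
      grind

theorem colour_trans {n : ℕ} {c : Sym2 (Fin n) → Bool} {t : Bool}
    (hno : ∀ a b d, ¬ UniqueColourTriangle c (!t) a b d) {x y z : Fin n}
    (hxy : x ≠ y) (hyz : y ≠ z) (hxz : x ≠ z) (h1 : c s(x, y) = t) (h2 : c s(y, z) = t) :
    c s(x, z) = t := by
  by_contra h
  refine hno x z y ⟨by simp; tauto, by cases t <;> simpa using h, ?_, by simpa using h1⟩
  rw [Sym2.eq_swap]
  simpa using h2

theorem not_disjoint_of_no_copy {n : ℕ} (hn : 5 ≤ n) {c : Sym2 (Fin n) → Bool} {t : Bool}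
    (hcopy : ¬ K2K3Copy n c 2 2) (hno : ∀ a b d, ¬ UniqueColourTriangle c (!t) a b d)
    {p q : Fin n} (hpq : p ≠ q) (hpqt : c s(p, q) ≠ t) {x y z w : Fin n}
    (hnd : ([x, y, z, w] : List (Fin n)).Nodup) (hxy : c s(x, y) = t) (hzw : c s(z, w) = t) :
    False := by
  have key : ∀ {x y z w v : Fin n}, ([x, y, z, w, v] : List (Fin n)).Nodup → c s(x, y) = t →
      c s(z, w) = t → c s(x, v) = t := by
    intro x y z w v hnd hxy hzw
    by_contra hxv
    have hyv : c s(y, v) ≠ t := by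
      intro hyv
      simp at hnd
      exact hxv (colour_trans hno (by tauto) (by tauto) (by tauto) hxy hyv)
    refine hcopy (K2K3Copy.of_colours t (x := z) (y := w) (a := x) (b := y) (d := v)
      ?_ hzw hxy ?_ ?_)
    · simp at hnd ⊢
      grind
    · cases t <;> simpa using hyv
    · cases t <;> simpa using hxv
  have outside : ∀ v, v ∉ ({x, y, z, w} : Finset (Fin n)) → c s(x, v) = t ∧ c s(z, v) = t := by
    intro v hv
    simp at hnd hv
    refine ⟨key (y := y) (z := z) (w := w) ?_ hxy hzw, key (y := w) (z := x) (w := y) ?_ hzw hxy⟩ <;>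
    · simp
      grind
  obtain ⟨v, hv⟩ := exists_notMem_of_card_lt ({x, y, z, w} : Finset (Fin n))
    (by have := Finset.card_le_four (a := x) (b := y) (c := z) (d := w); omega)
  obtain ⟨hxv, hzv⟩ := outside v hv
  simp at hnd hv
  have hxz : c s(x, z) = t :=
    colour_trans hno (y := v) (by tauto) (by tauto) (by tauto) hxv (by rwa [Sym2.eq_swap])
  have hxw : c s(x, w) = t :=
    colour_trans hno (y := z) (by tauto) (by tauto) (by tauto) hxz hzw
  have star : ∀ u, u ≠ x → c s(x, u) = t := by
    intro u hu
    by_cases hmem : u ∈ ({x, y, z, w} : Finset (Fin n))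
    · simp at hmem
      rcases hmem with rfl | rfl | rfl | rfl <;> tauto
    · exact (outside u hmem).1
  apply hpqt
  by_cases hp : p = x
  · subst hp
    exact star q (Ne.symm hpq)
  by_cases hq : q = x
  · subst hq
    rw [Sym2.eq_swap]
    exact star p hpq
  exact colour_trans hno (y := x) hp (Ne.symm hq) hpq (by rw [Sym2.eq_swap]; exact star p hp)
    (star q hq)

theorem card_colour_le_three {n : ℕ} (hn : 5 ≤ n) {c : Sym2 (Fin n) → Bool} {t : Bool}
    (hcopy : ¬ K2K3Copy n c 2 2) (hno : ∀ a b d, ¬ UniqueColourTriangle c (!t) a b d)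
    {p q : Fin n} (hpq : p ≠ q) (hpqt : c s(p, q) ≠ t) :
    ((⊤ : SimpleGraph (Fin n)).edgeFinset.filter (fun e => c e = t)).card ≤ 3 := by
  have disj : ∀ {x y z w : Fin n}, x ≠ y → z ≠ w → c s(x, y) = t → c s(z, w) = t →
      x = z ∨ x = w ∨ y = z ∨ y = w := by
    intro x y z w h1 h2 h3 h4
    by_contra! h
    refine not_disjoint_of_no_copy hn hcopy hno hpq hpqt (x := x) (y := y) (z := z) (w := w)
      ?_ h3 h4
    simp
    tauto
  by_cases hex : ∃ x y z : Fin n, x ≠ y ∧ x ≠ z ∧ y ≠ z ∧ c s(x, y) = t ∧ c s(x, z) = t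
  · obtain ⟨x, y, z, hxy, hxz, hyz, h1, h2⟩ := hex
    have h3 : c s(y, z) = t :=
      colour_trans hno (y := x) hxy.symm hxz hyz (by rwa [Sym2.eq_swap]) h2
    refine (Finset.card_le_card (t := {s(x, y), s(x, z), s(y, z)}) ?_).trans Finset.card_le_three
    intro e
    induction e with | _ u v =>
    intro he
    simp at he
    have d1 := disj he.1 hxy he.2 h1
    have d2 := disj he.1 hxz he.2 h2
    have d3 := disj he.1 hyz he.2 h3
    simp
    grind
  · refine le_trans (Finset.card_le_one.2 ?_) (by norm_num : 1 ≤ 3)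
    intro e he f hf
    induction e with | _ u v =>
    induction f with | _ z w =>
    simp at he hf
    have d := disj he.1 hf.1 he.2 hf.2
    by_contra hne
    apply hex
    have he' : c s(v, u) = t := by rw [Sym2.eq_swap]; exact he.2
    have hf' : c s(w, z) = t := by rw [Sym2.eq_swap]; exact hf.2
    simp only [Sym2.eq_iff, not_or, not_and] at hne
    rcases d with rfl | rfl | rfl | rfl
    · exact ⟨u, v, w, by grind⟩
    · exact ⟨u, v, z, by grind⟩
    · exact ⟨v, u, w, by grind⟩
    · exact ⟨v, u, z, by grind⟩

theorem exists_ne_of_colour_card_pos {n : ℕ} {c : Sym2 (Fin n) → Bool} {t : Bool}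
    (h : 0 < ((⊤ : SimpleGraph (Fin n)).edgeFinset.filter (fun e => c e = t)).card) :
    ∃ p q : Fin n, p ≠ q ∧ c s(p, q) = t := by
  obtain ⟨e, he⟩ := Finset.card_pos.1 h
  induction e with | _ p q =>
  exact ⟨p, q, by simpa using he⟩

theorem K2K3Copy.of_four_le {n : ℕ} (hn : 7 ≤ n) (c : Sym2 (Fin n) → Bool)
    (hc : 4 ≤ min (redEdges n c).card (blueEdges n c).card) : K2K3Copy n c 2 2 := by
  obtain ⟨hred, hblue⟩ := le_min_iff.1 hc
  by_contra hcopy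
  by_cases hex : ∃ a b d, UniqueColourTriangle c true a b d
  · obtain ⟨a, b, d, hT⟩ := hex
    obtain ⟨p, q, hpq, hcol⟩ := exists_ne_of_colour_card_pos (t := false)
      (lt_of_lt_of_le (by norm_num) hblue)
    have := card_colour_le_three (t := true) (by omega) hcopy
      (fun _ _ _ hT' => hcopy (hT.copy_of_opposite hn hT')) hpq (by simp [hcol])
    exact absurd (hred.trans this) (by norm_num)
  · push Not at hex
    obtain ⟨p, q, hpq, hcol⟩ := exists_ne_of_colour_card_pos (t := true)
      (lt_of_lt_of_le (by norm_num) hred)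
    have := card_colour_le_three (t := false) (by omega) hcopy hex hpq (by simp [hcol])
    exact absurd (hblue.trans this) (by norm_num)

theorem exists_colouring_without_balanced_copy {n : ℕ} (hn : 6 ≤ n) :
    ∃ c : Sym2 (Fin n) → Bool,
      min (redEdges n c).card (blueEdges n c).card = 3 ∧ ¬ K2K3Copy n c 2 2 := by
  classical
  refine ⟨fun e => decide (∀ v ∈ e, v.val < 3), ?_, ?_⟩
  · have hred : redEdges n (fun e => decide (∀ v ∈ e, v.val < 3)) =
        {s(⟨0, by omega⟩, ⟨1, by omega⟩), s(⟨0, by omega⟩, ⟨2, by omega⟩),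
          s(⟨1, by omega⟩, ⟨2, by omega⟩)} := by
      ext e
      induction e with | _ u v =>
      simp only [redEdges, Finset.mem_filter, SimpleGraph.mem_edgeFinset, SimpleGraph.mem_edgeSet,
        SimpleGraph.top_adj, decide_eq_true_eq, Sym2.ball, Finset.mem_insert,
        Finset.mem_singleton, Sym2.eq_iff, Fin.ext_iff, ne_eq]
      omega
    have hblue : ({s(⟨3, by omega⟩, ⟨4, by omega⟩), s(⟨3, by omega⟩, ⟨5, by omega⟩),
          s(⟨4, by omega⟩, ⟨5, by omega⟩)} : Finset (Sym2 (Fin n))) ⊆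
        blueEdges n (fun e => decide (∀ v ∈ e, v.val < 3)) := by
      intro e he
      simp at he
      rcases he with rfl | rfl | rfl <;> simp [blueEdges]
    have hblue' := Finset.card_le_card hblue
    rw [Finset.card_eq_three.2 ⟨_, _, _, by simp, by simp, by simp, rfl⟩] at hblue'
    rw [hred, Finset.card_eq_three.2 ⟨_, _, _, by simp, by simp, by simp, rfl⟩]
    exact min_eq_left hblue'
  · rintro ⟨x, y, a, b, d, hnd, hr, -⟩
    simp only [decide_eq_true_eq, Sym2.ball] at hr
    simp [Fin.ext_iff] at hnd
    split_ifs at hr <;> omega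

/-- For every `n ≥ 7`, `bal(n, K_2 ∪ K_3) = 3`: every 2-edge-colouring of `K_n` with
`min{|R|,|B|} ≥ 4` contains a copy of `K_2 ∪ K_3` with exactly two red and two blue edges,
and there is a 2-edge-colouring with `min{|R|,|B|} = 3` containing no such copy. -/
theorem bal_K2_union_K3 (n : ℕ) (hn : 7 ≤ n) :
    (∀ c : Sym2 (Fin n) → Bool,
        4 ≤ min (redEdges n c).card (blueEdges n c).card → K2K3Copy n c 2 2) ∧
    (∃ c : Sym2 (Fin n) → Bool,
        min (redEdges n c).card (blueEdges n c).card = 3 ∧ ¬ K2K3Copy n c 2 2) := by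
  exact ⟨fun c hc => K2K3Copy.of_four_le hn c hc,
    exists_colouring_without_balanced_copy (by omega)⟩
end

section
/- Let G be any graph with exactly three edges and let n ≥ max{6, |V(G)|}. Then every 2-edge-colouring of K_n with at least one red edge and at least one blue edge contains a balanced copy of G, i.e. a copy of G with either two red edges and one blue edge or two blue edges and one red edge; equivalently, bal(n,G) = 0. -/
/-- A partial injection between finite families extends to an injection of the whole type,
provided the target is large enough. -/
theorem exists_injective_extension {α β ι : Type*} [Fintype α] [Fintype β] [Finite ι]
    (h : Fintype.card α ≤ Fintype.card β) {v : ι → α} {w : ι → β}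
    (hv : Function.Injective v) (hw : Function.Injective w) :
    ∃ f : α → β, Function.Injective f ∧ ∀ i, f (v i) = w i := by
  classical
  obtain ⟨f₀⟩ := Function.Embedding.nonempty_of_card_le h
  have hfv : Function.Injective (f₀ ∘ v) := f₀.injective.comp hv
  let e : Set.range (f₀ ∘ v) ≃ Set.range w :=
    (Equiv.ofInjective _ hfv).symm.trans (Equiv.ofInjective _ hw)
  refine ⟨e.extendSubtype ∘ f₀, e.extendSubtype.injective.comp f₀.injective, fun i => ?_⟩
  have hi : f₀ (v i) ∈ Set.range (f₀ ∘ v) := ⟨i, rfl⟩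
  have hs : (Equiv.ofInjective _ hfv).symm ⟨f₀ (v i), hi⟩ = i :=
    Equiv.ofInjective_symm_apply hfv i
  rw [Function.comp_apply, Equiv.extendSubtype_apply_of_mem e _ hi]
  simp [e, hs]

/-- If any two edges of `K_n` sharing a vertex have the same colour, then all edges do. -/
theorem colour_eq_of_adjacent_eq {β : Type*} {c : Sym2 β → Bool}
    (h : ∀ x y z : β, x ≠ y → x ≠ z → y ≠ z → c s(x, y) = c s(x, z))
    {x y z w : β} (hxy : x ≠ y) (hzw : z ≠ w) : c s(x, y) = c s(z, w) := by
  have h' : ∀ x y z : β, x ≠ y → x ≠ z → c s(x, y) = c s(x, z) := fun x y z hy hz => by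
    by_cases hyz : y = z
    · rw [hyz]
    · exact h x y z hy hz hyz
  by_cases hxz : x = z
  · subst hxz
    exact h' x y w hxy hzw
  · rw [h' x y z hxy hxz, Sym2.eq_swap]
    exact h' z x w (Ne.symm hxz) hzw

/-- If two distinct edges of `G` receive the same colour under every injection of `G` into a
complete graph on at least five vertices, then that complete graph is monochromatic. -/
theorem colour_eq_of_forall_injective {α β : Type*} [Fintype α] [Fintype β]
    {G : SimpleGraph α} (h5 : 5 ≤ Fintype.card β) (hV : Fintype.card α ≤ Fintype.card β)
    {c : Sym2 β → Bool} {e₁ e₂ : Sym2 α} (h₁ : e₁ ∈ G.edgeSet) (h₂ : e₂ ∈ G.edgeSet)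
    (hne : e₁ ≠ e₂)
    (h : ∀ f : α → β, Function.Injective f → c (Sym2.map f e₁) = c (Sym2.map f e₂))
    {x y z w : β} (hxy : x ≠ y) (hzw : z ≠ w) : c s(x, y) = c s(z, w) := by
  classical
  refine colour_eq_of_adjacent_eq (fun x y z hxy hxz hyz => ?_) hxy hzw
  by_cases hshare : ∃ a, a ∈ e₁ ∧ a ∈ e₂
  · obtain ⟨a, ⟨b, rfl⟩, ⟨d, rfl⟩⟩ := hshare
    have hab : a ≠ b := G.ne_of_adj h₁
    have had : a ≠ d := G.ne_of_adj h₂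
    have hbd : b ≠ d := fun hbd => hne (by rw [hbd])
    have hv : Function.Injective ![a, b, d] := by
      intro i j; fin_cases i <;> fin_cases j <;> simp_all [Ne.symm]
    have hw : Function.Injective ![x, y, z] := by
      intro i j; fin_cases i <;> fin_cases j <;> simp_all [Ne.symm]
    obtain ⟨f, hf, hfv⟩ := exists_injective_extension hV hv hw
    have ha : f a = x := hfv 0
    have hb : f b = y := hfv 1
    have hd : f d = z := hfv 2
    simpa [ha, hb, hd] using h f hf
  · induction e₁ with | _ a b
    induction e₂ with | _ a' b'
    have hab : a ≠ b := G.ne_of_adj h₁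
    have hab' : a' ≠ b' := G.ne_of_adj h₂
    simp only [Sym2.mem_iff, not_exists, not_and_or, not_or] at hshare
    have ha := hshare a
    have hb := hshare b
    have hv : Function.Injective ![a, b, a', b'] := by
      intro i j; fin_cases i <;> fin_cases j <;> simp_all [eq_comm]
    have disjoint_eq : ∀ p q r s : β, p ≠ q → p ≠ r → p ≠ s → q ≠ r → q ≠ s → r ≠ s →
        c s(p, q) = c s(r, s) := by
      intro p q r s _ _ _ _ _ _
      have hw : Function.Injective ![p, q, r, s] := by
        intro i j; fin_cases i <;> fin_cases j <;> simp_all [Ne.symm]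
      obtain ⟨f, hf, hfv⟩ := exists_injective_extension hV hv hw
      have h0 : f a = p := hfv 0
      have h1 : f b = q := hfv 1
      have h2 : f a' = r := hfv 2
      have h3 : f b' = s := hfv 3
      simpa [h0, h1, h2, h3] using h f hf
    have hcard : 1 < ({x, y, z}ᶜ : Finset β).card := by
      have := Finset.card_le_three (a := x) (b := y) (c := z)
      rw [Finset.card_compl]
      omega
    obtain ⟨u, hu, v, hv, huv⟩ := Finset.one_lt_card.mp hcard
    simp only [Finset.mem_compl, Finset.mem_insert, Finset.mem_singleton, not_or] at hu hv
    rw [disjoint_eq x y u v hxy (Ne.symm hu.1) (Ne.symm hv.1) (Ne.symm hu.2.1)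
      (Ne.symm hv.2.1) huv]
    exact disjoint_eq u v x z huv hu.1 hu.2.2 hv.1 hv.2.2 hxz

/-- A subset of a three-element set which contains one of two given elements but not the other
has one or two elements. -/
theorem ncard_eq_two_or_one_of_mem_of_notMem {γ : Type*} {s t : Set γ} (ht : t.ncard = 3)
    (hst : s ⊆ t) {a b : γ} (ha : a ∈ s) (hb : b ∈ t) (hbs : b ∉ s) :
    s.ncard = 2 ∨ s.ncard = 1 := by
  have htf : t.Finite := Set.finite_of_ncard_ne_zero (by omega)
  have hlt : s.ncard < t.ncard :=
    Set.ncard_lt_ncard (hst.ssubset_of_ne fun h => hbs (h ▸ hb)) htf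
  have hpos : 0 < s.ncard := (Set.ncard_pos (htf.subset hst)).2 ⟨a, ha⟩
  omega

/-- Let `G` be any graph with exactly three edges and let `n ≥ max{6, |V(G)|}`.  Then
every 2-edge-colouring of `K_n` with at least one red edge and at least one blue edge
contains a balanced copy of `G`: an injective embedding of `G` into `K_n` such that among
the (three) images of the edges of `G` either exactly two are red (and one blue) or
exactly one is red (and two blue);  i.e. `bal(n, G) = 0`. -/
theorem bal_three_edges_zero {α : Type*} [Fintype α] (G : SimpleGraph α)
    (hG : G.edgeSet.ncard = 3) (n : ℕ) (h6 : 6 ≤ n) (hV : Fintype.card α ≤ n)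
    (c : Sym2 (Fin n) → Bool)
    (hred : 1 ≤ (redEdges n c).card) (hblue : 1 ≤ (blueEdges n c).card) :
    ∃ f : α → Fin n, Function.Injective f ∧
      ({e ∈ G.edgeSet | c (Sym2.map f e) = true}.ncard = 2 ∨
        {e ∈ G.edgeSet | c (Sym2.map f e) = true}.ncard = 1) := by
  obtain ⟨e₁, h₁, e₂, h₂, hne⟩ :=
    (Set.one_lt_ncard (Set.finite_of_ncard_ne_zero (by omega))).mp
      (show 1 < G.edgeSet.ncard by omega)
  by_contra hcon
  have hmono : ∀ f : α → Fin n, Function.Injective f →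
      c (Sym2.map f e₁) = c (Sym2.map f e₂) := by
    intro f hf
    by_contra hc
    refine hcon ⟨f, hf, ?_⟩
    cases hc₁ : c (Sym2.map f e₁) with
    | true =>
      exact ncard_eq_two_or_one_of_mem_of_notMem hG (Set.sep_subset _ _) (a := e₁) ⟨h₁, hc₁⟩ h₂
        fun hm => hc (hc₁.trans hm.2.symm)
    | false =>
      have hc₂ : c (Sym2.map f e₂) = true := by
        simpa [hc₁] using hc
      exact ncard_eq_two_or_one_of_mem_of_notMem hG (Set.sep_subset _ _) (a := e₂) ⟨h₂, hc₂⟩ h₁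
        fun hm => hc (hm.2.trans hc₂.symm)
  obtain ⟨r, hr⟩ := Finset.card_pos.mp hred
  obtain ⟨b, hb⟩ := Finset.card_pos.mp hblue
  induction r with | _ x y
  induction b with | _ z w
  simp only [redEdges, blueEdges, Finset.mem_filter, SimpleGraph.mem_edgeFinset,
    SimpleGraph.mem_edgeSet, SimpleGraph.top_adj] at hr hb
  have heq : c s(x, y) = c s(z, w) :=
    colour_eq_of_forall_injective (by simpa using by omega) (by simpa using hV) h₁ h₂ hne hmono
      hr.1 hb.1
  simp [hr.2, hb.2] at heq
end

section
/- Let G and H be graphs with the same number of edges, e(G) = e(H). Let r be an integer such that every red/blue colouring of the edges of a complete graph on at least r vertices contains a red copy of G or a blue copy of H, and suppose n ≥ |V(G)| + |V(H)| + r. Then every 2-edge-colouring of K_n that contains both a copy of G all of whose edges are red and a copy of H all of whose edges are blue contains a vertex-disjoint pair consisting of a monochromatic copy of G and a monochromatic copy of H in opposite colours; in particular K_n contains a balanced copy of the vertex-disjoint union G ∪ H, with e(G) red edges and e(G) blue edges. -/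
/-- Let `G` and `H` be graphs with `e(G) = e(H)`.  Let `r` be such that every red/blue
colouring of the edges of a complete graph on at least `r` vertices contains a red copy of
`G` or a blue copy of `H`, and let `n ≥ |V(G)| + |V(H)| + r`.  If a 2-edge-colouring `c`
of `K_n` (`true` = red, `false` = blue) contains an all-red copy of `G` and an all-blue
copy of `H`, then it contains a vertex-disjoint pair consisting of a monochromatic copy of
`G` and a monochromatic copy of `H` in opposite colours; in particular `K_n` contains a
balanced copy of the vertex-disjoint union `G ∪ H`, with `e(G)` red and `e(G)` blue
edges. -/
theorem disjoint_opposite_copies {α β : Type*} [Fintype α] [Fintype β]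
    (G : SimpleGraph α) (H : SimpleGraph β)
    (hE : G.edgeSet.ncard = H.edgeSet.ncard) (r n : ℕ)
    (hram : ∀ m : ℕ, r ≤ m → ∀ c : Sym2 (Fin m) → Bool,
      (∃ f : α → Fin m, Function.Injective f ∧ ∀ u v : α, G.Adj u v → c s(f u, f v) = true) ∨
      (∃ g : β → Fin m, Function.Injective g ∧ ∀ u v : β, H.Adj u v → c s(g u, g v) = false))
    (hn : Fintype.card α + Fintype.card β + r ≤ n)
    (c : Sym2 (Fin n) → Bool)
    (hredG : ∃ f : α → Fin n, Function.Injective f ∧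
      ∀ u v : α, G.Adj u v → c s(f u, f v) = true)
    (hblueH : ∃ g : β → Fin n, Function.Injective g ∧
      ∀ u v : β, H.Adj u v → c s(g u, g v) = false) :
    ((∃ f : α → Fin n, ∃ g : β → Fin n,
        Function.Injective f ∧ Function.Injective g ∧ (∀ u v, f u ≠ g v) ∧
        (∀ u v : α, G.Adj u v → c s(f u, f v) = true) ∧
        (∀ u v : β, H.Adj u v → c s(g u, g v) = false)) ∨
      (∃ f : α → Fin n, ∃ g : β → Fin n,
        Function.Injective f ∧ Function.Injective g ∧ (∀ u v, f u ≠ g v) ∧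
        (∀ u v : α, G.Adj u v → c s(f u, f v) = false) ∧
        (∀ u v : β, H.Adj u v → c s(g u, g v) = true))) ∧
    (∃ f : α → Fin n, ∃ g : β → Fin n,
        Function.Injective f ∧ Function.Injective g ∧ (∀ u v, f u ≠ g v) ∧
        {e ∈ G.edgeSet | c (Sym2.map f e) = true}.ncard +
          {e ∈ H.edgeSet | c (Sym2.map g e) = true}.ncard = G.edgeSet.ncard) := by
  classical
  obtain ⟨f, hf, hfr⟩ := hredG
  obtain ⟨g, hg, hgb⟩ := hblueH
  have key : ∃ f : α → Fin n, ∃ g : β → Fin n,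
      Function.Injective f ∧ Function.Injective g ∧ (∀ u v, f u ≠ g v) ∧
      (∀ u v : α, G.Adj u v → c s(f u, f v) = true) ∧
      (∀ u v : β, H.Adj u v → c s(g u, g v) = false) := by
    let S : Finset (Fin n) := Finset.univ.image f ∪ Finset.univ.image g
    have hS : S.card ≤ Fintype.card α + Fintype.card β :=
      (Finset.card_union_le _ _).trans (add_le_add Finset.card_image_le Finset.card_image_le)
    have hr : r ≤ Sᶜ.card := by
      rw [Finset.card_compl, Fintype.card_fin]
      omega
    let ι : Fin Sᶜ.card ↪o Fin n := Sᶜ.orderEmbOfFin rfl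
    have hι (x) : ι x ∉ S := Finset.mem_compl.1 (Finset.orderEmbOfFin_mem Sᶜ rfl x)
    have hιf (x u) : ι x ≠ f u := fun h => hι x (by simp [S, h])
    have hιg (x v) : ι x ≠ g v := fun h => hι x (by simp [S, h])
    obtain ⟨f', hf', hfr'⟩ | ⟨g', hg', hgb'⟩ := hram _ hr fun e => c (e.map ι)
    · exact ⟨ι ∘ f', g, ι.injective.comp hf', hg, fun u v => hιg _ v, hfr', hgb⟩
    · exact ⟨f, ι ∘ g', hf, ι.injective.comp hg', fun u v => (hιf _ u).symm, hfr, hgb'⟩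
  refine ⟨Or.inl key, ?_⟩
  obtain ⟨f, g, hf, hg, hfg, hfr, hgb⟩ := key
  refine ⟨f, g, hf, hg, hfg, ?_⟩
  have hG : {e ∈ G.edgeSet | c (Sym2.map f e) = true} = G.edgeSet :=
    Set.sep_eq_self_iff_mem_true.2 fun e => e.ind fun u v he => hfr u v he
  have hH : {e ∈ H.edgeSet | c (Sym2.map g e) = true} = ∅ :=
    Set.sep_eq_empty_iff_mem_false.2 fun e => e.ind fun u v he => by
      simp [hgb u v he]
  rw [hG, hH, Set.ncard_empty, add_zero]
end

section
/- Let G and H be bipartite graphs with e(G) = e(H). Then the vertex-disjoint union G ∪ H is balanceable: there exists n₀ such that for all n ≥ n₀, every 2-edge-colouring of K_n with min{|R|,|B|} > max{ex(n,G), ex(n,H)} contains a balanced copy of G ∪ H; in particular bal(n, G ∪ H) ≤ max{ex(n,G), ex(n,H)} for all n ≥ n₀. -/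
/-- `A` contains a (not necessarily induced) copy of `G`. -/
def HasCopy {α β : Type*} (G : SimpleGraph α) (A : SimpleGraph β) : Prop :=
  ∃ f : α → β, Function.Injective f ∧ ∀ u v : α, G.Adj u v → A.Adj (f u) (f v)

/-- The Turán number `ex(n, G)`: the maximum number of edges of a graph on `n` vertices
containing no copy of `G`. -/
noncomputable def exNum (n : ℕ) {α : Type*} (G : SimpleGraph α) : ℕ :=
  sSup {k : ℕ | ∃ A : SimpleGraph (Fin n), ¬ HasCopy G A ∧ A.edgeSet.ncard = k}

namespace SimpleGraph

open Finset Fintype Filter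

/-- The Turán number of a balanced complete bipartite graph is at most `n ^ 2 / 8 + O(1)`. -/
theorem exists_extremalNumber_completeEquipartiteGraph_two_le (t : ℕ) (ht : 0 < t) :
    ∃ C N : ℕ, ∀ n, N ≤ n →
      8 * extremalNumber n (completeEquipartiteGraph 2 t) ≤ C + n ^ 2 := by
  classical
  set K := completeEquipartiteGraph 2 t with hK
  have hKbot : K ≠ ⊥ := by
    rw [hK, Ne, completeEquipartiteGraph_eq_bot_iff]
    omega
  obtain ⟨N, hN⟩ := eventually_atTop.mp <|
    eventually_completeEquipartiteGraph_isContained_of_minDegree (ε := 1 / 8) (by norm_num) 1 t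
  refine ⟨8 * extremalNumber N K, N, fun n hn ↦ ?_⟩
  induction n, hn using Nat.le_induction with
  | base => omega
  | succ n hn ih =>
    obtain ⟨A, _, hA⟩ := exists_isExtremal_free (V := Fin (n + 1)) hKbot
    have hfree : K.Free A := hA.prop
    have hmin : 8 * A.minDegree < n + 1 := by
      by_contra! h
      refine hfree (hN (n + 1) (by omega) ?_)
      have : ((n + 1 : ℕ) : ℝ) ≤ 8 * (A.minDegree : ℝ) := by exact_mod_cast h
      push_cast at this ⊢
      linarith
    obtain ⟨v, hv⟩ := A.exists_minimal_degree_vertex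
    have hdel := card_edgeFinset_deleteIncidenceSet_le_extremalNumber hfree v
    rw [card_edgeFinset_deleteIncidenceSet, Fintype.card_fin, ← hv,
      card_edgeFinset_of_isExtremal_free hA, Fintype.card_fin, Nat.add_sub_cancel] at hdel
    nlinarith [Nat.sub_le_iff_le_add.mp hdel]

/-- A graph on `n` vertices with at least half of all edges contains, for large `n`, every
bipartite graph away from any prescribed set of at most `a` vertices. -/
theorem exists_copy_avoiding_of_colorable_two {β : Type*} [Fintype β] {H : SimpleGraph β}
    (hH : H.Colorable 2) (a : ℕ) :
    ∃ n₀ : ℕ, ∀ n, n₀ ≤ n → ∀ (B : SimpleGraph (Fin n)) (S : Finset (Fin n)), #S ≤ a →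
      n.choose 2 ≤ 2 * B.edgeSet.ncard →
      ∃ g : β → Fin n, Function.Injective g ∧ (∀ v, g v ∉ S) ∧
        ∀ u v, H.Adj u v → B.Adj (g u) (g v) := by
  classical
  obtain ⟨C, N, hCN⟩ :=
    exists_extremalNumber_completeEquipartiteGraph_two_le (card β + 1) (by omega)
  refine ⟨N + C + 8 * a + 3, fun n hn B S hS hB ↦ ?_⟩
  let A : SimpleGraph (Fin n) :=
    { Adj := fun u v ↦ B.Adj u v ∧ u ∉ S ∧ v ∉ S
      symm := ⟨fun u v h ↦ ⟨h.1.symm, h.2.2, h.2.1⟩⟩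
      loopless := ⟨fun u h ↦ B.loopless.irrefl u h.1⟩ }
  have hcard : #B.edgeFinset ≤ #A.edgeFinset + a * n := by
    have hsub : B.edgeFinset ⊆ A.edgeFinset ∪ (S ×ˢ univ).image fun p ↦ s(p.1, p.2) := by
      intro e
      induction e with | _ u v
      simp only [mem_union, mem_edgeFinset, mem_edgeSet, Finset.mem_image, mem_product, mem_univ,
        and_true, Prod.exists]
      intro huv
      by_cases hu : u ∈ S
      · exact .inr ⟨u, v, hu, rfl⟩
      by_cases hv : v ∈ S
      · exact .inr ⟨v, u, hv, Sym2.eq_swap⟩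
      · exact .inl ⟨huv, hu, hv⟩
    calc #B.edgeFinset
      _ ≤ #A.edgeFinset + #((S ×ˢ univ).image fun p ↦ s(p.1, p.2)) :=
          (card_le_card hsub).trans (card_union_le _ _)
      _ ≤ #A.edgeFinset + #S * n := by
          gcongr
          exact card_image_le.trans (by simp)
      _ ≤ #A.edgeFinset + a * n := by gcongr
  have hcont : completeEquipartiteGraph 2 (card β + 1) ⊑ A := by
    apply IsContained.of_extremalNumber_lt_card_edgeFinset
    rw [Fintype.card_fin]
    have h1 := hCN n (by omega)
    have h2 : n * (n - 1) ≤ 4 * #B.edgeFinset := by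
      rw [← coe_edgeFinset, Set.ncard_coe_finset] at hB
      rw [Nat.choose_two_right] at hB
      have := Nat.div_mul_cancel (Nat.even_mul_pred_self n).two_dvd
      omega
    obtain ⟨m, rfl⟩ : ∃ m, n = m + 1 := ⟨n - 1, by omega⟩
    rw [Nat.add_sub_cancel] at h2
    obtain ⟨k, rfl⟩ : ∃ k, m = N + C + 8 * a + 2 + k := ⟨m - (N + C + 8 * a + 2), by omega⟩
    nlinarith
  obtain ⟨coloring⟩ := hH
  have hHK : H ⊑ completeEquipartiteGraph 2 (card β + 1) :=
    isContained_completeEquipartiteGraph_of_colorable coloring _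
      fun c ↦ (card_subtype_le _).trans (Nat.le_succ _)
  obtain ⟨φ⟩ := hHK
  obtain ⟨ψ⟩ := hcont
  refine ⟨fun v ↦ ψ (φ v), ψ.injective.comp φ.injective, fun v ↦ ?_,
    fun u v huv ↦ (ψ.toHom.map_adj (φ.toHom.map_adj huv)).1⟩
  have hadj : (completeEquipartiteGraph 2 (card β + 1)).Adj (φ v) ((φ v).1 + 1, (φ v).2) := by
    rw [completeEquipartiteGraph_adj]
    exact (show ∀ i : Fin 2, i ≠ i + 1 by decide) _
  exact (ψ.toHom.map_adj hadj).2.1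

end SimpleGraph

theorem HasCopy.of_exNum_lt {α : Type*} {G : SimpleGraph α} {n : ℕ} {A : SimpleGraph (Fin n)}
    (h : exNum n G < A.edgeSet.ncard) : HasCopy G A := by
  by_contra hA
  refine h.not_ge (le_csSup (Set.Finite.bddAbove ?_) ⟨A, hA, rfl⟩)
  exact (Set.finite_range fun A : SimpleGraph (Fin n) ↦ A.edgeSet.ncard).subset
    fun k ⟨A, _, hk⟩ ↦ ⟨A, hk⟩

/-- The graph of the edges of `K_n` of colour `b`. -/
def colourGraph (n : ℕ) (c : Sym2 (Fin n) → Bool) (b : Bool) : SimpleGraph (Fin n) :=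
  SimpleGraph.fromEdgeSet {e | c e = b}

theorem ncard_edgeSet_colourGraph_true (n : ℕ) (c : Sym2 (Fin n) → Bool) :
    (colourGraph n c true).edgeSet.ncard = (redEdges n c).card := by
  rw [← Set.ncard_coe_finset]
  congr 1
  ext e
  simp [colourGraph, redEdges, and_comm]

theorem ncard_edgeSet_colourGraph_false (n : ℕ) (c : Sym2 (Fin n) → Bool) :
    (colourGraph n c false).edgeSet.ncard = (blueEdges n c).card := by
  rw [← Set.ncard_coe_finset]
  congr 1
  ext e
  simp [colourGraph, blueEdges, and_comm]

theorem colour_map_of_forall_adj {α : Type*} {G : SimpleGraph α} {n : ℕ}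
    {c : Sym2 (Fin n) → Bool} {b : Bool} {f : α → Fin n}
    (h : ∀ u v, G.Adj u v → (colourGraph n c b).Adj (f u) (f v)) :
    ∀ e ∈ G.edgeSet, c (Sym2.map f e) = b := by
  intro e
  induction e with | _ u v
  intro he
  exact ((SimpleGraph.fromEdgeSet_adj _).mp (h u v he)).1

theorem ncard_red_of_forall_eq {α : Type*} {G : SimpleGraph α} {n : ℕ}
    {c : Sym2 (Fin n) → Bool} {b : Bool} {f : α → Fin n}
    (h : ∀ e ∈ G.edgeSet, c (Sym2.map f e) = b) :
    {e ∈ G.edgeSet | c (Sym2.map f e) = true}.ncard = if b then G.edgeSet.ncard else 0 := by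
  cases b
  · rw [Set.sep_eq_empty_iff_mem_false.mpr fun e he ↦ by simp [h e he]]
    simp
  · rw [Set.sep_eq_self_iff_mem_true.mpr h]
    simp

/-- Let `G` and `H` be bipartite graphs with `e(G) = e(H)`.  Then the vertex-disjoint
union `G ∪ H` is balanceable: there is `n₀` such that for all `n ≥ n₀`, every
2-edge-colouring of `K_n` with `min{|R|,|B|} > max{ex(n,G), ex(n,H)}` contains a balanced
copy of `G ∪ H`, i.e. vertex-disjoint copies of `G` and `H` in `K_n` carrying exactly
`e(G)` red edges (and hence exactly `e(H)` blue edges) between them; in particular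
`bal(n, G ∪ H) ≤ max{ex(n,G), ex(n,H)}` for all `n ≥ n₀`. -/
theorem union_of_bipartite_balanceable {α β : Type*} [Fintype α] [Fintype β]
    (G : SimpleGraph α) (H : SimpleGraph β)
    (hGbip : G.Colorable 2) (hHbip : H.Colorable 2)
    (hE : G.edgeSet.ncard = H.edgeSet.ncard) :
    ∃ n₀ : ℕ, ∀ n : ℕ, n₀ ≤ n → ∀ c : Sym2 (Fin n) → Bool,
      max (exNum n G) (exNum n H) < min (redEdges n c).card (blueEdges n c).card →
      ∃ f : α → Fin n, ∃ g : β → Fin n,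
        Function.Injective f ∧ Function.Injective g ∧ (∀ u v, f u ≠ g v) ∧
        {e ∈ G.edgeSet | c (Sym2.map f e) = true}.ncard +
          {e ∈ H.edgeSet | c (Sym2.map g e) = true}.ncard = G.edgeSet.ncard := by
  classical
  obtain ⟨n₀, hn₀⟩ := SimpleGraph.exists_copy_avoiding_of_colorable_two hHbip (Fintype.card α)
  refine ⟨n₀, fun n hn c hc ↦ ?_⟩
  obtain ⟨b, hex, hhalf⟩ : ∃ b, exNum n G < (colourGraph n c b).edgeSet.ncard ∧
      n.choose 2 ≤ 2 * (colourGraph n c !b).edgeSet.ncard := by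
    have hsum := card_redEdges_add_card_blueEdges n c
    have hred := ncard_edgeSet_colourGraph_true n c
    have hblue := ncard_edgeSet_colourGraph_false n c
    rcases le_total (redEdges n c).card (blueEdges n c).card with h | h
    · exact ⟨true, by omega, by simp only [Bool.not_true]; omega⟩
    · exact ⟨false, by omega, by simp only [Bool.not_false]; omega⟩
  obtain ⟨f, hf, hfadj⟩ := HasCopy.of_exNum_lt hex
  obtain ⟨g, hg, hgf, hgadj⟩ := hn₀ n hn _ (Finset.univ.image f)
    (Finset.card_image_le.trans_eq Finset.card_univ) hhalf
  refine ⟨f, g, hf, hg, fun u v huv ↦ hgf v (by simp [← huv]), ?_⟩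
  rw [ncard_red_of_forall_eq (colour_map_of_forall_adj hfadj),
    ncard_red_of_forall_eq (colour_map_of_forall_adj hgadj), ← hE]
  cases b <;> simp
end

section
/- For every integer t ≥ 1 and every integer n > 4t+2, bal(n, (2t+1)K_2) = bal(n, 2tK_2). -/
/-- A copy of the matching `mK_2` in a 2-edge-coloured `K_n` having exactly `r` red edges:
`m` pairwise vertex-disjoint edges, exactly `r` of which are red. -/
def MatchingCopy (n : ℕ) (c : Sym2 (Fin n) → Bool) (m r : ℕ) : Prop :=
  ∃ f : Fin m → Fin n × Fin n,
    (Function.Injective fun p : Fin m × Bool => if p.2 then (f p.1).1 else (f p.1).2) ∧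
    (Finset.univ.filter fun i : Fin m => c s((f i).1, (f i).2) = true).card = r

/-- `bal(n, mK_2)`: the least `k` such that every 2-edge-colouring of `K_n` with
`min{|R|,|B|} > k` contains a balanced copy of `mK_2`, i.e. one with `⌊m/2⌋` or `⌈m/2⌉`
red edges (these coincide for `m` even). -/
noncomputable def balMatching (n m : ℕ) : ℕ :=
  sInf {k : ℕ | ∀ c : Sym2 (Fin n) → Bool,
    k < min (redEdges n c).card (blueEdges n c).card →
    MatchingCopy n c m (m / 2) ∨ MatchingCopy n c m ((m + 1) / 2)}

/-- Deleting a red edge from a matching. -/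
theorem MatchingCopy.delete_red {n : ℕ} {c : Sym2 (Fin n) → Bool} {m r : ℕ}
    (h : MatchingCopy n c (m + 1) (r + 1)) : MatchingCopy n c m r := by
  obtain ⟨f, hf, hr⟩ := h
  obtain ⟨i, hi⟩ : (Finset.univ.filter fun i => c s((f i).1, (f i).2) = true).Nonempty := by
    rw [← Finset.card_pos]; omega
  rw [Finset.mem_filter] at hi
  refine ⟨fun j => f (i.succAbove j), ?_, ?_⟩
  · rintro ⟨j, a⟩ ⟨k, b⟩ h
    have := @hf (i.succAbove j, a) (i.succAbove k, b) h
    simpa using this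
  · rw [Finset.card_filter, Fin.sum_univ_succAbove _ i, if_pos hi.2] at hr
    rw [Finset.card_filter]
    beta_reduce
    omega

/-- Deleting a blue edge from a matching. -/
theorem MatchingCopy.delete_blue {n : ℕ} {c : Sym2 (Fin n) → Bool} {m r : ℕ}
    (hrm : r ≤ m) (h : MatchingCopy n c (m + 1) r) : MatchingCopy n c m r := by
  obtain ⟨f, hf, hr⟩ := h
  obtain ⟨i, hi⟩ : ∃ i, c s((f i).1, (f i).2) ≠ true := by
    by_contra! h
    simp [h] at hr
    omega
  refine ⟨fun j => f (i.succAbove j), ?_, ?_⟩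
  · rintro ⟨j, a⟩ ⟨k, b⟩ h
    have := @hf (i.succAbove j, a) (i.succAbove k, b) h
    simpa using this
  · rw [Finset.card_filter, Fin.sum_univ_succAbove _ i, if_neg hi] at hr
    rw [Finset.card_filter]
    beta_reduce
    omega

/-- A matching missing at least two vertices extends by one edge. -/
theorem MatchingCopy.extend {n : ℕ} {c : Sym2 (Fin n) → Bool} {m r : ℕ}
    (hn : 2 * m + 2 ≤ n) (h : MatchingCopy n c m r) :
    MatchingCopy n c (m + 1) r ∨ MatchingCopy n c (m + 1) (r + 1) := by
  obtain ⟨f, hf, hr⟩ := h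
  set g : Fin m × Bool → Fin n := fun p => if p.2 then (f p.1).1 else (f p.1).2 with hg
  obtain ⟨a, ha, b, hb, hab⟩ : ∃ a ∈ (Finset.univ.image g)ᶜ, ∃ b ∈ (Finset.univ.image g)ᶜ,
      a ≠ b := by
    apply Finset.one_lt_card.mp
    rw [Finset.card_compl, Finset.card_image_of_injective _ hf]
    simp only [Finset.card_univ, Fintype.card_prod, Fintype.card_fin, Fintype.card_bool]
    omega
  simp only [Finset.mem_compl, Finset.mem_image, Finset.mem_univ, true_and, not_exists] at ha hb
  have hinj : Function.Injective fun p : Fin (m + 1) × Bool =>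
      if p.2 then ((Fin.cons (a, b) f : Fin (m + 1) → Fin n × Fin n) p.1).1
      else ((Fin.cons (a, b) f : Fin (m + 1) → Fin n × Fin n) p.1).2 := by
    rintro ⟨j, x⟩ ⟨k, y⟩ h
    have haj := fun j => ha (j, true)
    have haj' := fun j => ha (j, false)
    have hbj := fun j => hb (j, true)
    have hbj' := fun j => hb (j, false)
    simp only [hg, if_true, Bool.false_eq_true, if_false] at haj haj' hbj hbj'
    cases j using Fin.cases with
    | zero =>
      cases k using Fin.cases with
      | zero => cases x <;> cases y <;> simp at h ⊢ <;> grind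
      | succ k => cases x <;> cases y <;> simp at h ⊢ <;> grind
    | succ j =>
      cases k using Fin.cases with
      | zero => cases x <;> cases y <;> simp at h ⊢ <;> grind
      | succ k =>
        have := @hf (j, x) (k, y) (by simpa using h)
        simpa using this
  rw [Finset.card_filter] at hr
  by_cases hc : c s(a, b) = true
  · refine Or.inr ⟨Fin.cons (a, b) f, hinj, ?_⟩
    rw [Finset.card_filter, Fin.sum_univ_succ]
    simp only [Fin.cons_zero, Fin.cons_succ, hr, if_pos hc]
    omega
  · refine Or.inl ⟨Fin.cons (a, b) f, hinj, ?_⟩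
    rw [Finset.card_filter, Fin.sum_univ_succ]
    simp only [Fin.cons_zero, Fin.cons_succ, hr, if_neg hc]
    omega

/-- For every `t ≥ 1` and every `n > 4t+2`, `bal(n, (2t+1)K_2) = bal(n, 2tK_2)`. -/
theorem bal_odd_matching_eq_bal_even_matching (t : ℕ) (ht : 1 ≤ t) (n : ℕ)
    (hn : 4 * t + 2 < n) :
    balMatching n (2 * t + 1) = balMatching n (2 * t) := by
  have key (c : Sym2 (Fin n) → Bool) :
      (MatchingCopy n c (2 * t + 1) t ∨ MatchingCopy n c (2 * t + 1) (t + 1)) ↔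
        MatchingCopy n c (2 * t) t :=
    ⟨fun h => h.elim (fun h => h.delete_blue (by omega)) fun h => h.delete_red,
      fun h => h.extend (by omega)⟩
  have h₁ : (2 * t + 1) / 2 = t := by omega
  have h₂ : (2 * t + 1 + 1) / 2 = t + 1 := by omega
  have h₃ : 2 * t / 2 = t := by omega
  simp only [balMatching, h₁, h₂, h₃, key, or_self]
end
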